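/- arXiv:1110.0082 — 14 statements merged into one kernel-verified Lean document; each statement's English description precedes it below -/
import Mathlib

section
/- Every bisequential rectifiable space G is metrizable. -/
open Filter Topology Set

/-- A topological space `G` is rectifiable if there exist a homeomorphism
`φ : G × G → G × G` and an element `e ∈ G` such that `π₁ ∘ φ = π₁` and
`φ (x, x) = (x, e)` for every `x ∈ G`. -/
def RectifiableSpace (G : Type*) [TopologicalSpace G] : Prop :=
  ∃ (φ : G × G ≃ₜ G × G) (e : G),
    (∀ z : G × G, (φ z).1 = z.1) ∧ ∀ x : G, φ (x, x) = (x, e)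

/-- A prefilter on `X` is a family of nonempty subsets of `X` such that for any
`P₁, P₂` in the family there is a member `P` with `P ⊆ P₁ ∩ P₂`. -/
def IsPrefilter {X : Type*} (ζ : Set (Set X)) : Prop :=
  (∀ P ∈ ζ, P.Nonempty) ∧ ∀ P₁ ∈ ζ, ∀ P₂ ∈ ζ, ∃ P ∈ ζ, P ⊆ P₁ ∩ P₂

/-- A prefilter `ζ` converges to `x` if every open neighborhood of `x` contains
an element of `ζ`. -/
def PrefilterConvergesTo {X : Type*} [TopologicalSpace X] (ζ : Set (Set X)) (x : X) : Prop :=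
  ∀ U : Set X, IsOpen U → x ∈ U → ∃ P ∈ ζ, P ⊆ U

/-- A prefilter `ζ` accumulates to `x` if `x` belongs to the closure of every
element of `ζ`. -/
def PrefilterAccumulatesTo {X : Type*} [TopologicalSpace X] (ζ : Set (Set X)) (x : X) : Prop :=
  ∀ P ∈ ζ, x ∈ closure P

/-- Two prefilters are synchronous if any member of one meets any member of the other. -/
def SynchronousPrefilters {X : Type*} (ζ η : Set (Set X)) : Prop :=
  ∀ P ∈ ζ, ∀ Q ∈ η, (P ∩ Q).Nonempty

/-- A space `X` is bisequential if for every prefilter `ζ` on `X` accumulating to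
a point `x ∈ X` there exists a countable prefilter `ξ` on `X` converging to `x`
such that `ζ` and `ξ` are synchronous. -/
def Bisequential (X : Type*) [TopologicalSpace X] : Prop :=
  ∀ (ζ : Set (Set X)) (x : X), IsPrefilter ζ → PrefilterAccumulatesTo ζ x →
    ∃ ξ : Set (Set X), ξ.Countable ∧ IsPrefilter ξ ∧ PrefilterConvergesTo ξ x ∧
      SynchronousPrefilters ζ ξ

/-- A rectification yields continuous operations `p` (playing the role of `x * u`) and `q`
(playing the role of `x⁻¹ * y`). -/
theorem RectifiableSpace.exists_operations {G : Type*} [TopologicalSpace G]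
    (h : RectifiableSpace G) :
    ∃ (p q : G × G → G) (e : G), Continuous p ∧ Continuous q ∧ (∀ x, q (x, x) = e) ∧
      (∀ x y, p (x, q (x, y)) = y) ∧ ∀ x u, q (x, p (x, u)) = u := by
  obtain ⟨φ, e, hfst, hdiag⟩ := h
  have hsymm_fst : ∀ z, (φ.symm z).1 = z.1 := fun z => by
    rw [← hfst, φ.apply_symm_apply]
  refine ⟨fun z => (φ.symm z).2, fun z => (φ z).2, e, by fun_prop, by fun_prop,
    fun x => by simp only [hdiag], fun x y => ?_, fun x u => ?_⟩
  · have : (x, (φ (x, y)).2) = φ (x, y) := Prod.ext (hfst (x, y)).symm rfl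
    simp only [this, φ.symm_apply_apply]
  · have : (x, (φ.symm (x, u)).2) = φ.symm (x, u) := Prod.ext (hsymm_fst (x, u)).symm rfl
    simp only [this, φ.apply_symm_apply]

/-- A regular bisequential space has countable π-character. -/
theorem Bisequential.exists_countable_piBase {X : Type*} [TopologicalSpace X] [RegularSpace X]
    (h : Bisequential X) (x : X) :
    ∃ B : Set (Set X), B.Countable ∧ (∀ P ∈ B, IsOpen P ∧ P.Nonempty) ∧
      ∀ U ∈ 𝓝 x, ∃ P ∈ B, P ⊆ U := by
  let ζ : Set (Set X) := {P | ∃ U D, U ∈ 𝓝 x ∧ IsOpen D ∧ Dense D ∧ P = U ∩ D}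
  have hacc : PrefilterAccumulatesTo ζ x := by
    rintro _ ⟨U, D, hU, -, hD, rfl⟩
    rw [mem_closure_iff_nhds]
    intro V hV
    obtain ⟨y, hy, hyD⟩ := hD.inter_nhds_nonempty (inter_mem hV hU)
    exact ⟨y, hyD.1, hyD.2, hy⟩
  have hpre : IsPrefilter ζ := by
    refine ⟨fun P hP => closure_nonempty_iff.mp ⟨x, hacc P hP⟩, ?_⟩
    rintro _ ⟨U, D, hU, hDo, hD, rfl⟩ _ ⟨U', D', hU', hDo', hD', rfl⟩
    refine ⟨_, ⟨U ∩ U', D ∩ D', inter_mem hU hU', hDo.inter hDo',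
      hD.inter_of_isOpen_left hD' hDo, rfl⟩, ?_⟩
    exact (inter_inter_inter_comm U U' D D').subset
  obtain ⟨ξ, hξc, -, hξ, hsync⟩ := h ζ x hpre hacc
  refine ⟨(fun A => interior (closure A)) '' ξ, hξc.image _, ?_, fun U hU => ?_⟩
  · rintro _ ⟨A, hA, rfl⟩
    refine ⟨isOpen_interior, ?_⟩
    by_contra hempty
    have hdense : Dense (closure A)ᶜ :=
      interior_eq_empty_iff_dense_compl.mp (not_nonempty_iff_eq_empty.mp hempty)
    obtain ⟨y, ⟨-, hy⟩, hyA⟩ := hsync _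
      ⟨univ, (closure A)ᶜ, univ_mem, isClosed_closure.isOpen_compl, hdense, rfl⟩ A hA
    exact hy (subset_closure hyA)
  · obtain ⟨C, hC, hCc, hCU⟩ := exists_mem_nhds_isClosed_subset hU
    obtain ⟨A, hA, hAC⟩ := hξ (interior C) isOpen_interior (mem_interior_iff_mem_nhds.mpr hC)
    exact ⟨_, ⟨A, hA, rfl⟩, interior_subset.trans <|
      (closure_minimal (hAC.trans interior_subset) hCc).trans hCU⟩

/-- If the neighborhoods of the diagonal `W n` satisfy a local triangle condition, every open
neighborhood `O` of the diagonal contains `V ○ V` for some symmetric open neighborhood `V` of the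
diagonal. -/
theorem exists_isOpen_symm_comp_subset {X : Type*} [TopologicalSpace X]
    {W : ℕ → Set (X × X)} (hanti : Antitone W) (hopen : ∀ n, IsOpen (W n))
    (hrefl : ∀ n x, (x, x) ∈ W n) (hsymm : ∀ n x y, (x, y) ∈ W n → (y, x) ∈ W n)
    (htri : ∀ x, ∀ U ∈ 𝓝 x, ∃ n, ∀ a b c,
      (x, a) ∈ W n → (a, b) ∈ W n → (b, c) ∈ W n → c ∈ U)
    {O : Set (X × X)} (hO : IsOpen O) (hOrefl : ∀ x, (x, x) ∈ O) :
    ∃ V : Set (X × X), (IsOpen V ∧ (∀ x, (x, x) ∈ V) ∧ ∀ x y, (x, y) ∈ V → (y, x) ∈ V) ∧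
      ∀ a b c, (a, b) ∈ V → (b, c) ∈ V → (a, c) ∈ O := by
  have hloc : ∀ x, ∃ A ∈ 𝓝 x, A ×ˢ A ⊆ O := fun x =>
    by
    have hx := hO.mem_nhds (hOrefl x)
    rwa [nhds_prod_eq, mem_prod_self_iff] at hx
  choose A hA hAO using hloc
  choose m hm using fun x => htri x (A x) (hA x)
  refine ⟨⋃ x, (Prod.mk x ⁻¹' W (m x)) ×ˢ (Prod.mk x ⁻¹' W (m x)), ⟨?_, ?_, ?_⟩, ?_⟩
  · exact isOpen_iUnion fun x =>
      ((hopen _).preimage (by fun_prop)).prod ((hopen _).preimage (by fun_prop))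
  · exact fun x => mem_iUnion.mpr ⟨x, hrefl _ x, hrefl _ x⟩
  · intro x y hxy
    obtain ⟨z, hx, hy⟩ := mem_iUnion.mp hxy
    exact mem_iUnion.mpr ⟨z, hy, hx⟩
  · intro a b c hab hbc
    obtain ⟨x, ha, hb⟩ := mem_iUnion.mp hab
    obtain ⟨y, hb', hc⟩ := mem_iUnion.mp hbc
    simp only [mem_preimage] at ha hb hb' hc
    rcases le_total (m x) (m y) with hle | hle
    · exact hAO x ⟨hm x a a a ha (hrefl _ a) (hrefl _ a),
        hm x b y c hb (hsymm _ _ _ (hanti hle hb')) (hanti hle hc)⟩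
    · exact hAO y ⟨hm y b x a hb' (hsymm _ _ _ (hanti hle hb)) (hanti hle ha),
        hm y c c c hc (hrefl _ c) (hrefl _ c)⟩

/-- A form of Frink's metrization theorem. -/
theorem metrizableSpace_of_local_triangle {X : Type*} [TopologicalSpace X] [T0Space X]
    {W : ℕ → Set (X × X)} (hanti : Antitone W) (hopen : ∀ n, IsOpen (W n))
    (hrefl : ∀ n x, (x, x) ∈ W n) (hsymm : ∀ n x y, (x, y) ∈ W n → (y, x) ∈ W n)
    (htri : ∀ x, ∀ U ∈ 𝓝 x, ∃ n, ∀ a b c,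
      (x, a) ∈ W n → (a, b) ∈ W n → (b, c) ∈ W n → c ∈ U) :
    TopologicalSpace.MetrizableSpace X := by
  let Good : Set (X × X) → Prop := fun O =>
    IsOpen O ∧ (∀ x, (x, x) ∈ O) ∧ ∀ x y, (x, y) ∈ O → (y, x) ∈ O
  have hstep : ∀ (n : ℕ) (O : Subtype Good), ∃ V : Subtype Good,
      ∀ a b c, (a, b) ∈ V.1 → (b, c) ∈ V.1 → (a, c) ∈ O.1 ∩ W n := fun n O => by
    obtain ⟨V, hV, hVO⟩ := exists_isOpen_symm_comp_subset hanti hopen hrefl hsymm htri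
      (O.2.1.inter (hopen n)) fun x => ⟨O.2.2.1 x, hrefl n x⟩
    exact ⟨⟨V, hV⟩, hVO⟩
  choose next hnext using hstep
  let V : ℕ → Subtype Good := fun n =>
    Nat.rec ⟨univ, isOpen_univ, fun _ => trivial, fun _ _ _ => trivial⟩ next n
  have hV : ∀ n a b c, (a, b) ∈ (V (n + 1)).1 → (b, c) ∈ (V (n + 1)).1 →
      (a, c) ∈ (V n).1 ∩ W n := fun n => hnext n (V n)
  have hVsucc : ∀ n, (V (n + 1)).1 ⊆ (V n).1 ∩ W n := fun n ⟨a, b⟩ hab =>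
    hV n a a b ((V (n + 1)).2.2.1 a) hab
  have hVanti : Antitone fun n => (V n).1 :=
    antitone_nat_of_succ_le fun n => (hVsucc n).trans inter_subset_left
  have hbasis : (⨅ n, 𝓟 (V n).1).HasBasis (fun _ => True) fun n => (V n).1 :=
    hasBasis_iInf_principal hVanti.directed_ge
  let u : UniformSpace X :=
    { uniformity := ⨅ n, 𝓟 (V n).1
      symm := (hbasis.tendsto_iff hbasis).mpr fun n _ =>
        ⟨n, trivial, fun z hz => (V n).2.2.2 z.1 z.2 hz⟩
      comp := by
        refine hbasis.ge_iff.mpr fun n _ => ?_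
        refine mem_of_superset (mem_lift' (hbasis.mem_of_mem (i := n + 1) trivial)) ?_
        rintro ⟨a, c⟩ ⟨b, hab, hbc⟩
        exact (hV n a b c hab hbc).1
      nhds_eq_comap_uniformity := fun x => by
        refine le_antisymm ?_ fun U hU => ?_
        · refine (hbasis.comap _).ge_iff.mpr fun n _ => ?_
          exact ((V n).2.1.preimage (by fun_prop)).mem_nhds ((V n).2.2.1 x)
        · obtain ⟨n, hn⟩ := htri x U hU
          refine (hbasis.comap _).mem_iff.mpr ⟨n + 1, trivial, fun y hy => ?_⟩
          exact hn y y y (hVsucc n hy).2 (hrefl n y) (hrefl n y) }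
  have : (uniformity X).IsCountablyGenerated := hbasis.isCountablyGenerated
  exact UniformSpace.metrizableSpace

/-- In a rectifiable space, a countable π-base at the neutral element gives a countable base
there. -/
theorem isCountablyGenerated_nhds_of_countable_piBase {G : Type*} [TopologicalSpace G]
    {p q : G × G → G} {e : G} (hp : Continuous p) (hq : Continuous q)
    (hqe : ∀ x, q (x, x) = e) (hpq : ∀ x y, p (x, q (x, y)) = y)
    (hqp : ∀ x u, q (x, p (x, u)) = u)
    {B : Set (Set G)} (hB : B.Countable) (hBo : ∀ P ∈ B, IsOpen P ∧ P.Nonempty)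
    (hπ : ∀ U ∈ 𝓝 e, ∃ P ∈ B, P ⊆ U) :
    (𝓝 e).IsCountablyGenerated := by
  have hmem : ∀ P ∈ B, q '' P ×ˢ P ∈ 𝓝 e := fun P hP => by
    obtain ⟨hPo, x, hx⟩ := hBo P hP
    have hpe : p (x, e) = x := by rw [← hqe x, hpq]
    have hnhds : (fun u => p (x, u)) ⁻¹' P ∈ 𝓝 e :=
      (hPo.preimage (by fun_prop)).mem_nhds (by simpa [hpe] using hx)
    exact mem_of_superset hnhds fun u hu => ⟨(x, p (x, u)), ⟨hx, hu⟩, hqp x u⟩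
  have hbasis : (𝓝 e).HasBasis (fun P => P ∈ B) fun P => q '' P ×ˢ P := by
    refine ⟨fun U => ⟨fun hU => ?_, fun ⟨P, hP, hPU⟩ => mem_of_superset (hmem P hP) hPU⟩⟩
    have hpre : q ⁻¹' U ∈ 𝓝 (e, e) := hq.continuousAt.preimage_mem_nhds (by rwa [hqe])
    rw [nhds_prod_eq, mem_prod_self_iff] at hpre
    obtain ⟨V, hV, hVU⟩ := hpre
    obtain ⟨P, hP, hPV⟩ := hπ V hV
    exact ⟨P, hP, image_subset_iff.mpr ((prod_mono hPV hPV).trans hVU)⟩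
  exact (HasCountableBasis.mk hbasis hB).isCountablyGenerated

/-- Every bisequential rectifiable space is metrizable. -/
theorem bisequential_rectifiable_metrizable {G : Type*} [TopologicalSpace G]
    [T1Space G] [RegularSpace G] (hrec : RectifiableSpace G) (hbis : Bisequential G) :
    TopologicalSpace.MetrizableSpace G := by
  obtain ⟨p, q, e, hp, hq, hqe, hpq, hqp⟩ := hrec.exists_operations
  obtain ⟨B, hB, hBo, hπ⟩ := hbis.exists_countable_piBase e
  have := isCountablyGenerated_nhds_of_countable_piBase hp hq hqe hpq hqp hB hBo hπ
  have hpe : ∀ x, p (x, e) = x := fun x => by rw [← hqe x, hpq]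
  obtain ⟨U, hU, hbasis⟩ := (nhds_basis_opens e).exists_antitone_subbasis
  refine metrizableSpace_of_local_triangle
    (W := fun n => {z | q z ∈ U n ∧ q z.swap ∈ U n}) ?_ ?_ ?_ ?_ ?_
  · exact fun m n hmn z hz => ⟨hbasis.antitone hmn hz.1, hbasis.antitone hmn hz.2⟩
  · exact fun n => ((hU n).2.preimage hq).inter ((hU n).2.preimage (hq.comp continuous_swap))
  · exact fun n x => ⟨(hqe x).symm ▸ (hU n).1, (hqe x).symm ▸ (hU n).1⟩
  · exact fun n x y h => ⟨h.2, h.1⟩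
  · intro x N hN
    have hcont : Continuous fun t : G × G × G => p (p (p (x, t.1), t.2.1), t.2.2) := by
      fun_prop
    have hpre := hcont.continuousAt.preimage_mem_nhds (x := (e, e, e)) (t := N)
      (by simpa only [hpe] using hN)
    rw [nhds_prod_eq, nhds_prod_eq] at hpre
    obtain ⟨n, -, hn⟩ := (hbasis.prod (hbasis.prod hbasis)).1.mem_iff.mp hpre
    refine ⟨n, fun a b c ha hb hc => ?_⟩
    have hmem : (q (x, a), q (a, b), q (b, c)) ∈ U n ×ˢ U n ×ˢ U n := ⟨ha.1, hb.1, hc.1⟩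
    simpa only [mem_preimage, hpq] using hn hmem
end

section
/- Suppose that {V_n(x) : n ∈ ℕ, x ∈ G} is a weak base in a rectifiable space G. For each x ∈ G and each n ∈ ℕ, put W_n(x) = x · V_n(e). Then {W_n(x) : n ∈ ℕ, x ∈ G} is a weak base in G. -/
open Filter Topology Set

/-- A family `P = ⋃ₓ Pₓ` is a weak base for `X` if: (a) each `Pₓ` is directed
downwards; (b) each `Pₓ` is a network at `x` (every member contains `x`, and every
open set containing `x` contains a member); and (c) a set `S ⊆ X` is open whenever
for each `x ∈ S` some member of `Pₓ` is contained in `S`. -/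
def IsWeakBase {X : Type*} [TopologicalSpace X] (Fam : X → Set (Set X)) : Prop :=
  (∀ x : X, ∀ U ∈ Fam x, ∀ V ∈ Fam x, ∃ W ∈ Fam x, W ⊆ U ∩ V) ∧
  (∀ x : X, ∀ P ∈ Fam x, x ∈ P) ∧
  (∀ x : X, ∀ U : Set X, IsOpen U → x ∈ U → ∃ P ∈ Fam x, P ⊆ U) ∧
  (∀ S : Set X, (∀ x ∈ S, ∃ P ∈ Fam x, P ⊆ S) → IsOpen S)

/-- In a Hausdorff space, a sequence converging to `x` is eventually in each member at `x` of a
weak base. -/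
theorem IsWeakBase.eventually_mem {X : Type*} [TopologicalSpace X] [T2Space X]
    {Fam : X → Set (Set X)} (h : IsWeakBase Fam) {x : X} {u : ℕ → X}
    (hu : Tendsto u atTop (𝓝 x)) {P : Set X} (hP : P ∈ Fam x) : ∀ᶠ k in atTop, u k ∈ P := by
  by_contra hfreq
  obtain ⟨ψ, hψ, hnot⟩ := extraction_of_frequently_atTop (not_eventually.mp hfreq)
  have hv : Tendsto (u ∘ ψ) atTop (𝓝 x) := hu.comp hψ.tendsto_atTop
  have hopen : IsOpen (range (u ∘ ψ))ᶜ := by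
    refine h.2.2.2 _ fun y hy => ?_
    by_cases hyx : y = x
    · subst hyx
      refine ⟨P, hP, ?_⟩
      rintro _ hz ⟨k, rfl⟩
      exact hnot k hz
    · obtain ⟨Q, hQ, hsub⟩ := h.2.2.1 y (insert x (range (u ∘ ψ)))ᶜ
        hv.isCompact_insert_range.isClosed.isOpen_compl (by
          rintro (rfl | hmem)
          · exact hyx rfl
          · exact hy hmem)
      exact ⟨Q, hQ, hsub.trans (compl_subset_compl.mpr (subset_insert _ _))⟩
  have hx : x ∈ (range (u ∘ ψ))ᶜ := by
    rintro ⟨k, hk⟩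
    exact hnot k (by simpa [← hk] using h.2.1 x P hP)
  obtain ⟨k, hk⟩ := (hv.eventually (hopen.mem_nhds hx)).exists
  exact hk ⟨k, rfl⟩

/-- In a space with a pointwise countable weak base, every sequentially open set is open. -/
theorem IsWeakBase.isOpen_of_seq {X : Type*} [TopologicalSpace X] {V : X → ℕ → Set X}
    (h : IsWeakBase fun x => range (V x)) {S : Set X}
    (hS : ∀ x ∈ S, ∀ u : ℕ → X, Tendsto u atTop (𝓝 x) → ∃ k, u k ∈ S) : IsOpen S := by
  refine h.2.2.2 S fun x hx => ?_
  have hdir : Directed (· ≥ ·) fun n => 𝓟 (V x n) := by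
    intro i j
    obtain ⟨_, ⟨k, rfl⟩, hk⟩ := h.1 x _ ⟨i, rfl⟩ _ ⟨j, rfl⟩
    exact ⟨k, principal_mono.mpr (hk.trans inter_subset_left),
      principal_mono.mpr (hk.trans inter_subset_right)⟩
  have hle : ⨅ n, 𝓟 (V x n) ≤ 𝓝 x := by
    intro U hU
    obtain ⟨O, hOU, hO, hxO⟩ := mem_nhds_iff.mp hU
    obtain ⟨_, ⟨n, rfl⟩, hn⟩ := h.2.2.1 x O hO hxO
    exact mem_iInf_of_mem n (mem_principal.mpr (hn.trans hOU))
  have hmem : S ∈ ⨅ n, 𝓟 (V x n) := by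
    by_contra hnot
    obtain ⟨u, hu, huS⟩ := exists_seq_forall_of_frequently (not_eventually.mp hnot)
    obtain ⟨k, hk⟩ := hS x hx u (hu.mono_right hle)
    exact huS k hk
  obtain ⟨n, hn⟩ := (mem_iInf_of_directed hdir S).mp hmem
  exact ⟨V x n, ⟨n, rfl⟩, mem_principal.mp hn⟩

/-- Suppose `{V_n(x) : n ∈ ℕ, x ∈ G}` is a weak base in a rectifiable space `G`
(with rectification `φ` and right neutral element `e`, and multiplication
`x · y = p (x, y)` where `p = π₂ ∘ φ⁻¹`). For each `x ∈ G` and `n ∈ ℕ`, put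
`W_n(x) = x · V_n(e)`. Then `{W_n(x) : n ∈ ℕ, x ∈ G}` is a weak base in `G`. -/
theorem weakBase_translate {G : Type*} [TopologicalSpace G] [T1Space G] [RegularSpace G]
    (φ : G × G ≃ₜ G × G) (e : G)
    (hφ₁ : ∀ z : G × G, (φ z).1 = z.1) (hφ₂ : ∀ x : G, φ (x, x) = (x, e))
    (V : G → ℕ → Set G)
    (hV : IsWeakBase (fun x => Set.range (V x))) :
    IsWeakBase (fun x => Set.range
      (fun n => (fun y => (φ.symm (x, y)).2) '' V e n)) := by
  have hpe (x : G) : (φ.symm (x, e)).2 = x := by rw [← hφ₂ x, φ.symm_apply_apply]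
  have hpq (x y : G) : (φ.symm (x, (φ (x, y)).2)).2 = y := by
    rw [show (x, (φ (x, y)).2) = φ (x, y) from Prod.ext (hφ₁ (x, y)).symm rfl,
      φ.symm_apply_apply]
  refine ⟨?_, ?_, ?_, ?_⟩
  · rintro x _ ⟨i, rfl⟩ _ ⟨j, rfl⟩
    obtain ⟨_, ⟨k, rfl⟩, hk⟩ := hV.1 e _ ⟨i, rfl⟩ _ ⟨j, rfl⟩
    exact ⟨_, ⟨k, rfl⟩, subset_inter (image_mono (hk.trans inter_subset_left))
      (image_mono (hk.trans inter_subset_right))⟩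
  · rintro x _ ⟨n, rfl⟩
    exact ⟨e, hV.2.1 e _ ⟨n, rfl⟩, hpe x⟩
  · intro x U hU hxU
    have hcont : Continuous fun y => (φ.symm (x, y)).2 := by fun_prop
    obtain ⟨_, ⟨n, rfl⟩, hn⟩ := hV.2.2.1 e _ (hU.preimage hcont)
      (show (φ.symm (x, e)).2 ∈ U by rwa [hpe])
    exact ⟨_, ⟨n, rfl⟩, image_subset_iff.mpr hn⟩
  · intro S hS
    refine hV.isOpen_of_seq fun x hx u hu => ?_
    obtain ⟨_, ⟨n, rfl⟩, hn⟩ := hS x hx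
    have hcont : Continuous fun y => (φ (x, y)).2 := by fun_prop
    have hq : Tendsto (fun k => (φ (x, u k)).2) atTop (𝓝 e) := by
      simpa [hφ₂, Function.comp_def] using (hcont.tendsto x).comp hu
    obtain ⟨k, hk⟩ := (hV.eventually_mem hq ⟨n, rfl⟩).exists
    exact ⟨k, hn ⟨_, hk, hpq x (u k)⟩⟩
end

section
/- Every weakly first-countable rectifiable space G is metrizable. -/
open Filter Topology Set

/-- A space `X` is weakly first-countable if it has a weak base `Fam` with each
`Fam x` countable. -/
def WeaklyFirstCountable (X : Type*) [TopologicalSpace X] : Prop :=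
  ∃ Fam : X → Set (Set X), IsWeakBase Fam ∧ ∀ x : X, (Fam x).Countable

/-- The filter generated by the members at `x` of a weak base. -/
theorem IsWeakBase.exists_filter {X : Type*} [TopologicalSpace X] {Fam : X → Set (Set X)}
    (h : IsWeakBase Fam) (hc : ∀ x, (Fam x).Countable) :
    ∃ F : X → Filter X, (∀ x, (F x).IsCountablyGenerated) ∧ (∀ x, pure x ≤ F x) ∧
      (∀ x, F x ≤ 𝓝 x) ∧ ∀ S : Set X, (∀ x ∈ S, S ∈ F x) → IsOpen S := by
  obtain ⟨hdir, hself, hnet, hopen⟩ := h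
  have hbasis : ∀ x, (⨅ P ∈ Fam x, 𝓟 P).HasBasis (fun P => P ∈ Fam x) id := fun x => by
    refine hasBasis_biInf_principal (fun U hU V hV => ?_) ?_
    · obtain ⟨W, hW, hWUV⟩ := hdir x U hU V hV
      exact ⟨W, hW, fun z hz => (hWUV hz).1, fun z hz => (hWUV hz).2⟩
    · obtain ⟨P, hP, -⟩ := hnet x univ isOpen_univ (mem_univ x)
      exact ⟨P, hP⟩
  refine ⟨fun x => ⨅ P ∈ Fam x, 𝓟 P, fun x => ?_, fun x => ?_, fun x => ?_, fun S hS => ?_⟩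
  · exact HasCountableBasis.isCountablyGenerated ⟨hbasis x, hc x⟩
  · exact le_iInf₂ fun P hP => by simpa using hself x P hP
  · intro N hN
    obtain ⟨U, hUN, hU, hxU⟩ := mem_nhds_iff.1 hN
    obtain ⟨P, hP, hPU⟩ := hnet x U hU hxU
    exact (hbasis x).mem_iff.2 ⟨P, hP, hPU.trans hUN⟩
  · exact hopen S fun x hx => (hbasis x).mem_iff.1 (hS x hx)

section WeakFilter

variable {X : Type*} [TopologicalSpace X] [T2Space X] {F : X → Filter X}

/-- Convergent sequences converge along the filters generating the topology. -/
theorem tendsto_of_tendsto_nhds_of_isOpen (hF : ∀ x, F x ≤ 𝓝 x)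
    (hopen : ∀ S : Set X, (∀ x ∈ S, S ∈ F x) → IsOpen S) (hpure : ∀ x, pure x ≤ F x)
    {u : ℕ → X} {x : X} (hu : Tendsto u atTop (𝓝 x)) : Tendsto u atTop (F x) := by
  intro B hB
  by_contra hnot
  have hfreq : ∃ᶠ n in atTop, u n ∉ B := not_eventually.1 hnot
  obtain ⟨s, hs, hsB⟩ := extraction_of_frequently_atTop hfreq
  have hus : Tendsto (u ∘ s) atTop (𝓝 x) := hu.comp hs.tendsto_atTop
  have hclosed : IsClosed (insert x (range (u ∘ s))) := hus.isCompact_insert_range.isClosed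
  have hBx : x ∈ B := hpure x hB
  have hS : IsOpen (range (u ∘ s))ᶜ := by
    refine hopen _ fun z hz => ?_
    by_cases hzx : z = x
    · subst hzx
      refine mem_of_superset hB ?_
      rintro _ hb ⟨n, rfl⟩
      exact hsB n hb
    · refine hF z (mem_of_superset (hclosed.isOpen_compl.mem_nhds ?_)
        (compl_subset_compl.2 (subset_insert _ _)))
      rintro (h | h)
      exacts [hzx h, hz h]
  have hx : x ∈ (range (u ∘ s))ᶜ := by
    rintro ⟨n, hn⟩
    exact hsB n (by rw [← hn] at hBx; exact hBx)
  obtain ⟨n, hn⟩ := (hus.eventually (hS.mem_nhds hx)).exists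
  exact hn ⟨n, rfl⟩

end WeakFilter

/-- In a Hausdorff rectifiable space, countably generated filters determining the topology are
the neighbourhood filters. Here `(x, y) ↦ (x, q x y)` is the
rectification and `(x, y) ↦ (x, p x y)` its inverse. -/
theorem eq_nhds_of_rectification {G : Type*} [TopologicalSpace G] [T2Space G]
    {F : G → Filter G} (hcount : ∀ x, (F x).IsCountablyGenerated) (hpure : ∀ x, pure x ≤ F x)
    (hF : ∀ x, F x ≤ 𝓝 x) (hopen : ∀ S : Set G, (∀ x ∈ S, S ∈ F x) → IsOpen S)
    {p q : G → G → G} {e : G} (hp : Continuous fun z : G × G => p z.1 z.2)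
    (hq : Continuous fun z : G × G => q z.1 z.2) (hpq : ∀ x y, p x (q x y) = y)
    (hqe : ∀ x, q x x = e) (x : G) : F x = 𝓝 x := by
  have hpe : ∀ x, p x e = x := fun x => by rw [← hqe x, hpq]
  have hqF : ∀ x, Tendsto (q x) (F x) (F e) := fun x => by
    refine tendsto_of_seq_tendsto fun u hu => ?_
    refine tendsto_of_tendsto_nhds_of_isOpen hF hopen hpure ?_
    have hc : Tendsto (q x) (𝓝 x) (𝓝 (q x x)) := (hq.comp (Continuous.prodMk_right x)).tendsto x
    rw [hqe] at hc
    exact hc.comp (hu.mono_right (hF x))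
  have hppF : ∀ x, Tendsto (fun z : G × G => p (p x z.1) z.2) (F e ×ˢ F e) (F x) := fun x => by
    refine tendsto_of_seq_tendsto fun u hu => ?_
    refine tendsto_of_tendsto_nhds_of_isOpen hF hopen hpure ?_
    have hcont : Continuous fun z : G × G => p (p x z.1) z.2 :=
      hp.comp ((hp.comp (continuous_const.prodMk continuous_fst)).prodMk continuous_snd)
    have hc := hcont.tendsto (e, e)
    simp only [hpe] at hc
    refine hc.comp (hu.mono_right ?_)
    rw [nhds_prod_eq]
    exact Filter.prod_mono (hF e) (hF e)
  have key : ∀ x, ∀ S ∈ F x, {z | S ∈ F z} ∈ F x := fun x S hS => by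
    obtain ⟨A, hA, B, hB, hAB⟩ := Filter.mem_prod_iff.1 (hppF x hS)
    filter_upwards [hqF x hA] with z hz
    filter_upwards [hqF z hB] with w hw
    have := hAB (mk_mem_prod hz hw)
    simpa only [mem_preimage, hpq] using this
  refine le_antisymm (hF x) fun S hS => ?_
  have hint : IsOpen {z | S ∈ F z} := hopen _ fun z hz => key z S hz
  exact mem_of_superset (hint.mem_nhds hS) fun z hz => hpure z hz

/-- A form of Frink's metrization theorem. -/
theorem metrizableSpace_of_forall_exists_inter_nonempty {X : Type*} [TopologicalSpace X]
    [T0Space X] {V : ℕ → X → Set X} (hanti : ∀ x, Antitone fun n => V n x)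
    (hmem : ∀ n x, V n x ∈ 𝓝 x)
    (h : ∀ x, ∀ N ∈ 𝓝 x, ∃ m, ∀ y, (V m x ∩ V m y).Nonempty → V m y ⊆ N) :
    TopologicalSpace.MetrizableSpace X := by
  choose m hm using fun (n : ℕ) (x : X) => h x (V n x) (hmem n x)
  let k : ℕ → X → ℕ := fun n x => Nat.rec 0 (fun _ j => max (j + 1) (m j x)) n
  have hk_succ : ∀ n x, k (n + 1) x = max (k n x + 1) (m (k n x) x) := fun _ _ => rfl
  have hk_mono : ∀ x, Monotone fun n => k n x := fun x =>
    monotone_nat_of_le_succ fun n => by rw [hk_succ]; omega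
  have hk_le : ∀ n x, n ≤ k n x := fun n x => by
    induction n with
    | zero => exact Nat.zero_le _
    | succ n ih => rw [hk_succ]; omega
  have hk_sub : ∀ n a b, k (n + 1) a ≤ k (n + 1) b →
      (V (k (n + 1) a) a ∩ V (k (n + 1) b) b).Nonempty →
      V (k (n + 1) b) b ⊆ V (k n a) a := fun n a b hab hne => by
    have h1 : m (k n a) a ≤ k (n + 1) a := by rw [hk_succ]; exact le_max_right _ _
    refine (hanti b (h1.trans hab)).trans (hm _ a b (hne.mono ?_))
    exact inter_subset_inter (hanti a h1) (hanti b (h1.trans hab))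
  let E : ℕ → Set (X × X) := fun n => ⋃ a, V (k n a) a ×ˢ V (k n a) a
  have hE : ∀ n x y, (x, y) ∈ E n ↔ ∃ a, x ∈ V (k n a) a ∧ y ∈ V (k n a) a := fun n x y => by
    simp [E]
  have hE_anti : Antitone E := fun i j hij => iUnion_mono fun a =>
    prod_mono (hanti a (hk_mono a hij)) (hanti a (hk_mono a hij))
  have hbasis : (⨅ n, 𝓟 (E n)).HasBasis (fun _ => True) E :=
    hasBasis_iInf_principal hE_anti.directed_ge
  have hE_refl : ∀ n x, (x, x) ∈ E n := fun n x =>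
    (hE n x x).2 ⟨x, mem_of_mem_nhds (hmem _ x), mem_of_mem_nhds (hmem _ x)⟩
  have hE_comp : ∀ n x y z, (x, y) ∈ E (n + 1) → (y, z) ∈ E (n + 1) → (x, z) ∈ E n := by
    intro n x y z hxy hyz
    obtain ⟨a, hxa, hya⟩ := (hE (n + 1) x y).1 hxy
    obtain ⟨b, hyb, hzb⟩ := (hE (n + 1) y z).1 hyz
    rcases le_total (k (n + 1) a) (k (n + 1) b) with hab | hab
    · exact (hE n x z).2 ⟨a, hanti a (hk_mono a n.le_succ) hxa, hk_sub n a b hab ⟨y, hya, hyb⟩ hzb⟩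
    · exact (hE n x z).2 ⟨b, hk_sub n b a hab ⟨y, hyb, hya⟩ hxa, hanti b (hk_mono b n.le_succ) hzb⟩
  let core : UniformSpace.Core X := UniformSpace.Core.mk (⨅ n, 𝓟 (E n))
    (hbasis.ge_iff.2 fun n _ => by
      rintro ⟨x, y⟩ hxy
      obtain rfl : x = y := by simpa using hxy
      exact hE_refl n x)
    (hbasis.tendsto_iff hbasis |>.2 fun n _ => ⟨n, trivial, fun z hz => by
      obtain ⟨a, h1, h2⟩ := (hE n z.1 z.2).1 hz
      exact (hE n z.2 z.1).2 ⟨a, h2, h1⟩⟩)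
    ((hbasis.lift' (monotone_id.relComp monotone_id)).le_basis_iff hbasis |>.2 fun n _ =>
      ⟨n + 1, trivial, by
        rintro ⟨x, z⟩ ⟨y, hxy, hyz⟩
        exact hE_comp n x y z hxy hyz⟩)
  have hnhds : ∀ x, 𝓝 x = core.uniformity.comap (Prod.mk x) := fun x => by
    refine le_antisymm ((hbasis.comap _).ge_iff.2 fun n _ => ?_) fun N hN => ?_
    · exact mem_of_superset (hmem (k n x) x) fun y hy =>
        (hE n x y).2 ⟨x, mem_of_mem_nhds (hmem _ x), hy⟩
    · obtain ⟨n, hn⟩ := h x N hN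
      refine (hbasis.comap _).mem_iff.2 ⟨n, trivial, fun y hy => ?_⟩
      obtain ⟨a, hxa, hya⟩ := (hE n x y).1 hy
      exact hn a ⟨x, mem_of_mem_nhds (hmem n x), hanti a (hk_le n a) hxa⟩
        (hanti a (hk_le n a) hya)
  let _ : UniformSpace X :=
    { uniformity := core.uniformity
      symm := core.symm
      comp := core.comp
      nhds_eq_comap_uniformity := hnhds }
  have : (uniformity X).IsCountablyGenerated :=
    HasCountableBasis.isCountablyGenerated ⟨hbasis, to_countable _⟩
  exact UniformSpace.metrizableSpace

/-- A rectifiable space whose neighbourhood filter at the neutral point is countably generated is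
metrizable. -/
theorem metrizableSpace_of_rectification {G : Type*} [TopologicalSpace G] [T0Space G]
    {p q : G → G → G} {e : G} (hp : Continuous fun z : G × G => p z.1 z.2)
    (hq : Continuous fun z : G × G => q z.1 z.2) (hpq : ∀ x y, p x (q x y) = y)
    (hqe : ∀ x, q x x = e) (he : (𝓝 e).IsCountablyGenerated) :
    TopologicalSpace.MetrizableSpace G := by
  have hpe : ∀ x, p x e = x := fun x => by rw [← hqe x, hpq]
  obtain ⟨B, hB⟩ := (𝓝 e).exists_antitone_basis
  refine metrizableSpace_of_forall_exists_inter_nonempty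
    (V := fun n x => {y | q x y ∈ B n ∧ q y x ∈ B n}) (fun x i j hij y hy =>
      ⟨hB.antitone hij hy.1, hB.antitone hij hy.2⟩) (fun n x => ?_) fun x N hN => ?_
  · have h1 : Tendsto (fun y => q x y) (𝓝 x) (𝓝 e) := by
      have := (hq.comp (Continuous.prodMk_right x)).tendsto x
      simpa only [Function.comp_def, hqe] using this
    have h2 : Tendsto (fun y => q y x) (𝓝 x) (𝓝 e) := by
      have := (hq.comp (Continuous.prodMk_left x)).tendsto x
      simpa only [Function.comp_def, hqe] using this
    exact Filter.inter_mem (h1 (hB.mem n)) (h2 (hB.mem n))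
  · have hcont : Continuous fun u : G × G × G => p (p (p x u.1) u.2.1) u.2.2 :=
      hp.comp ((hp.comp ((hp.comp (continuous_const.prodMk continuous_fst)).prodMk
        (continuous_fst.comp continuous_snd))).prodMk (continuous_snd.comp continuous_snd))
    have hc := hcont.tendsto (e, e, e)
    simp only [hpe, nhds_prod_eq] at hc
    obtain ⟨n, -, hn⟩ := ((hB.prod (hB.prod hB)).toHasBasis.mem_iff).1 (hc hN)
    refine ⟨n, ?_⟩
    rintro y ⟨z, hxz, hyz⟩ w hw
    have := hn (mk_mem_prod hxz.1 (mk_mem_prod hyz.2 hw.1))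
    simpa only [mem_preimage, hpq] using this

/-- Every weakly first-countable rectifiable space is metrizable. -/
theorem weaklyFirstCountable_rectifiable_metrizable {G : Type*} [TopologicalSpace G]
    [T1Space G] [RegularSpace G] (hrec : RectifiableSpace G)
    (hwfc : WeaklyFirstCountable G) :
    TopologicalSpace.MetrizableSpace G := by
  obtain ⟨φ, e, hφ, hφe⟩ := hrec
  obtain ⟨Fam, hFam, hc⟩ := hwfc
  obtain ⟨F, hcount, hpure, hF, hopen⟩ := hFam.exists_filter hc
  have hp : Continuous fun z : G × G => (φ.symm (z.1, z.2)).2 :=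
    continuous_snd.comp φ.symm.continuous
  have hq : Continuous fun z : G × G => (φ (z.1, z.2)).2 := continuous_snd.comp φ.continuous
  have hpq : ∀ x y, (φ.symm (x, (φ (x, y)).2)).2 = y := fun x y => by
    have : (x, (φ (x, y)).2) = φ (x, y) := Prod.ext (hφ (x, y)).symm rfl
    rw [this, φ.symm_apply_apply]
  have hqe : ∀ x, (φ (x, x)).2 = e := fun x => by rw [hφe]
  have he := eq_nhds_of_rectification (p := fun x y => (φ.symm (x, y)).2)
    (q := fun x y => (φ (x, y)).2) hcount hpure hF hopen hp hq hpq hqe e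
  exact metrizableSpace_of_rectification (p := fun x y => (φ.symm (x, y)).2)
    (q := fun x y => (φ (x, y)).2) hp hq hpq hqe (he ▸ hcount e)
end

section
/- The product of a Fréchet-Urysohn rectifiable space G with a first-countable space M is Fréchet-Urysohn. -/
open Filter Topology Set

/-- A space `X` is Fréchet–Urysohn if for each subset `A ⊆ X` and each point
`x ∈ closure A` there exists a sequence of points of `A` converging to `x`. -/
def FrechetUrysohn (X : Type*) [TopologicalSpace X] : Prop :=
  ∀ (A : Set X) (x : X), x ∈ closure A →
    ∃ u : ℕ → X, (∀ n, u n ∈ A) ∧ Tendsto u atTop (𝓝 x)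

/-- In a rectifiable space, every point `x` admits a jointly continuous family of maps `F b`
sending `x` to `b`, with a jointly continuous family of left inverses. -/
theorem RectifiableSpace.exists_translation {G : Type*} [TopologicalSpace G]
    (hrec : RectifiableSpace G) (x : G) :
    ∃ F H : G × G → G, Continuous F ∧ Continuous H ∧ (∀ b, F (b, x) = b) ∧
      H (x, x) = x ∧ ∀ b a, H (b, F (b, a)) = a := by
  obtain ⟨φ, e, hfst, hdiag⟩ := hrec
  have hsymm : ∀ b, φ.symm (b, e) = (b, b) := fun b => by
    rw [← hdiag b, φ.symm_apply_apply]
  have hfst' : ∀ z, (φ.symm z).1 = z.1 := fun z => by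
    rw [← hfst (φ.symm z), φ.apply_symm_apply]
  refine ⟨fun z => (φ.symm (z.1, (φ (x, z.2)).2)).2, fun z => (φ.symm (x, (φ z).2)).2,
    by fun_prop, by fun_prop, fun b => ?_, ?_, fun b a => ?_⟩
  · simp [hdiag, hsymm]
  · simp [hdiag, hsymm]
  · have h₁ : (b, (φ.symm (b, (φ (x, a)).2)).2) = φ.symm (b, (φ (x, a)).2) :=
      Prod.ext (hfst' (b, (φ (x, a)).2)).symm rfl
    have h₂ : (x, (φ (x, a)).2) = φ (x, a) := Prod.ext (hfst (x, a)).symm rfl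
    simp only [h₁, φ.apply_symm_apply, h₂, φ.symm_apply_apply]

/-- A Fréchet–Urysohn rectifiable Hausdorff space is strongly Fréchet: if `x` lies in the closure
of every `A n`, then some sequence converging to `x` selects points from the sets `A n` with
indices tending to infinity. -/
theorem FrechetUrysohn.exists_tendsto_of_forall_mem_closure {G : Type*} [TopologicalSpace G]
    [T2Space G] (hFU : FrechetUrysohn G) (hrec : RectifiableSpace G) {A : ℕ → Set G} {x : G}
    (hx : ∀ n, x ∈ closure (A n)) :
    ∃ (a : ℕ → G) (i : ℕ → ℕ), Tendsto i atTop atTop ∧ (∀ k, a k ∈ A (i k)) ∧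
      Tendsto a atTop (𝓝 x) := by
  by_cases hiso : x ∈ closure ({x}ᶜ : Set G)
  · obtain ⟨b, hbx, hb⟩ := hFU _ _ hiso
    obtain ⟨F, H, hF, hH, hFx, hHx, hHF⟩ := hrec.exists_translation x
    choose U W hU hW hbU hxW hUW using fun n => t2_separation (hbx n)
    have hmem : x ∈ closure {z | ∃ n, ∃ a ∈ A n, F (b n, a) ∈ U n ∧ F (b n, a) = z} := by
      refine mem_closure_iff.2 fun O hO hxO => ?_
      obtain ⟨n, hn⟩ := (hb.eventually_mem (hO.mem_nhds hxO)).exists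
      have hcont : Continuous fun y => F (b n, y) := by fun_prop
      obtain ⟨a, ⟨haO, haU⟩, haA⟩ := mem_closure_iff.1 (hx n) _
        ((hO.inter (hU n)).preimage hcont) (by simpa [hFx] using ⟨hn, hbU n⟩)
      exact ⟨_, haO, n, a, haA, haU, rfl⟩
    obtain ⟨z, hz, hzx⟩ := hFU _ _ hmem
    choose i a haA haU haz using hz
    have hi : Tendsto i atTop atTop := by
      refine tendsto_atTop.2 fun N => ?_
      have hW' : ∀ᶠ k in atTop, ∀ n ∈ Finset.range N, z k ∈ W n :=
        (Filter.eventually_all_finset _).2 fun n _ =>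
          hzx.eventually_mem ((hW n).mem_nhds (hxW n))
      filter_upwards [hW'] with k hk
      by_contra! hlt
      exact (hUW (i k)).le_bot ⟨haU k, haz k ▸ hk _ (Finset.mem_range.2 hlt)⟩
    refine ⟨a, i, hi, haA, ?_⟩
    have hlim := (hH.tendsto (x, x)).comp ((hb.comp hi).prodMk_nhds hzx)
    rw [hHx] at hlim
    refine hlim.congr fun k => ?_
    simp [← haz k, hHF]
  · have hopen : IsOpen ({x} : Set G) := by
      rw [← isClosed_compl_iff, ← closure_subset_iff_isClosed]
      exact fun y hy hyx => hiso (mem_singleton_iff.1 hyx ▸ hy)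
    refine ⟨fun _ => x, id, tendsto_id, fun k => ?_, tendsto_const_nhds⟩
    obtain ⟨y, rfl, hy⟩ := mem_closure_iff.1 (hx k) _ hopen rfl
    exact hy

/-- The product of a Fréchet–Urysohn rectifiable space `G` with a
first-countable space `M` is Fréchet–Urysohn. -/
theorem rectifiable_frechetUrysohn_prod_firstCountable {G M : Type*}
    [TopologicalSpace G] [T1Space G] [RegularSpace G]
    [TopologicalSpace M] [T1Space M] [RegularSpace M] [FirstCountableTopology M]
    (hrec : RectifiableSpace G) (hFU : FrechetUrysohn G) :
    FrechetUrysohn (G × M) := by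
  rintro A ⟨x, m⟩ hA
  obtain ⟨V, hV⟩ := (𝓝 m).exists_antitone_basis
  have hx : ∀ n, x ∈ closure {g | ∃ y ∈ V n, (g, y) ∈ A} := fun n =>
    mem_closure_iff_nhds.2 fun O hO => by
      obtain ⟨⟨g, y⟩, ⟨hg, hy⟩, hgy⟩ :=
        mem_closure_iff_nhds.1 hA _ (prod_mem_nhds hO (hV.1.mem_of_mem (i := n) trivial))
      exact ⟨g, hg, y, hy, hgy⟩
  obtain ⟨a, i, hi, ha, hax⟩ := hFU.exists_tendsto_of_forall_mem_closure hrec hx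
  choose y hyV hyA using ha
  refine ⟨fun k => (a k, y k), hyA, hax.prodMk_nhds ?_⟩
  refine hV.1.tendsto_right_iff.2 fun n _ => ?_
  filter_upwards [hi.eventually_ge_atTop n] with k hk
  exact hV.2 hk (hyV k)
end

section
/- For a rectifiable space G the following conditions are equivalent: (1) every compact subspace of G is first-countable; (2) every compact subspace of G is metrizable. -/
open Filter Topology Set

/-- A compact Hausdorff space whose diagonal is the fibre of a continuous map to a Hausdorff
space over a point with a countable neighbourhood base is metrizable. -/
theorem metrizableSpace_of_diagonal_eq_fiber {X Y : Type*} [TopologicalSpace X] [CompactSpace X]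
    [T2Space X] [TopologicalSpace Y] [T2Space Y] {f : X × X → Y} (hf : Continuous f) (y : Y)
    [(𝓝 y).IsCountablyGenerated] (hy : f ⁻¹' {y} = diagonal X) :
    TopologicalSpace.MetrizableSpace X := by
  let := uniformSpaceOfCompactR1 (γ := X)
  have huniformity : uniformity X = comap f (𝓝 y) := by
    rw [← nhdsSet_diagonal_eq_uniformity, ← hy, hf.isClosedMap.comap_nhds_eq hf]
  have : (uniformity X).IsCountablyGenerated := huniformity ▸ inferInstance
  exact UniformSpace.metrizableSpace

/-- In a rectifiable space there is a continuous binary operation whose fibre over some point is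
the diagonal. -/
theorem RectifiableSpace.exists_continuous_eq_iff {G : Type*} [TopologicalSpace G]
    (hrec : RectifiableSpace G) :
    ∃ (q : G × G → G) (e : G), Continuous q ∧ ∀ x y, q (x, y) = e ↔ x = y := by
  obtain ⟨φ, e, hfst, hdiag⟩ := hrec
  refine ⟨fun z ↦ (φ z).2, e, by fun_prop, fun x y ↦ ⟨fun h ↦ ?_, ?_⟩⟩
  · have hxy : φ (x, y) = φ (x, x) := by
      rw [hdiag]
      exact Prod.ext (hfst (x, y)) h
    exact (congrArg Prod.snd (φ.injective hxy)).symm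
  · rintro rfl
    simp [hdiag]

/-- For a rectifiable space `G` the following are equivalent:
(1) every compact subspace of `G` is first-countable;
(2) every compact subspace of `G` is metrizable. -/
theorem rectifiable_compact_firstCountable_iff_metrizable {G : Type*}
    [TopologicalSpace G] [T1Space G] [RegularSpace G] (hrec : RectifiableSpace G) :
    (∀ K : Set G, IsCompact K → FirstCountableTopology K) ↔
      (∀ K : Set G, IsCompact K → TopologicalSpace.MetrizableSpace K) := by
  refine ⟨fun h K hK ↦ ?_, fun h K hK ↦ ?_⟩
  · obtain ⟨q, e, hq, hqe⟩ := hrec.exists_continuous_eq_iff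
    have : CompactSpace K := isCompact_iff_compactSpace.mp hK
    let L : Set G := insert e (q '' K ×ˢ K)
    have : FirstCountableTopology L := h L (((hK.prod hK).image hq).insert e)
    let f : K × K → L := fun z ↦
      ⟨q (z.1, z.2), mem_insert_of_mem e (mem_image_of_mem q ⟨z.1.2, z.2.2⟩)⟩
    have hf : Continuous f := by fun_prop
    refine metrizableSpace_of_diagonal_eq_fiber hf ⟨e, mem_insert e _⟩ ?_
    ext ⟨x, y⟩
    simp [f, hqe, Subtype.ext_iff]
  · have := h K hK
    infer_instance
end

section
/- If a rectifiable space G is pointwise canonically weakly pseudocompact, then G is a Moscow space. -/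
open Filter Topology Set

/-- A space `X` is Moscow if for each open subset `U` of `X` and each
`x ∈ closure U` there exists a Gδ-set `P` in `X` with `x ∈ P ⊆ closure U`. -/
def MoscowSpace (X : Type*) [TopologicalSpace X] : Prop :=
  ∀ U : Set X, IsOpen U → ∀ x ∈ closure U,
    ∃ P : Set X, IsGδ P ∧ x ∈ P ∧ P ⊆ closure U

/-- A point `x ∈ X` is a point of canonical weak pseudocompactness (cwp-point)
if for every regular open `U ⊆ X` with `x ∈ closure U` there is a sequence
`{A n}` of subsets of `U` with `x ∈ closure (A n)` for all `n`, such that every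
indexed family `{O n}` of open sets with `O n ∩ A n ≠ ∅` for all `n` has an
accumulation point in `X` (a point every neighborhood of which meets `O n` for
infinitely many `n`). -/
def CwpPoint {X : Type*} [TopologicalSpace X] (x : X) : Prop :=
  ∀ U : Set X, U = interior (closure U) → x ∈ closure U →
    ∃ A : ℕ → Set X, (∀ n, A n ⊆ U) ∧ (∀ n, x ∈ closure (A n)) ∧
      ∀ O : ℕ → Set X, (∀ n, IsOpen (O n)) → (∀ n, (O n ∩ A n).Nonempty) →
        ∃ z : X, ∀ V ∈ 𝓝 z, {n : ℕ | (V ∩ O n).Nonempty}.Infinite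

/-- A space is pointwise canonically weakly pseudocompact if each point is a
cwp-point. -/
def PointwiseCanonicallyWeaklyPseudocompact (X : Type*) [TopologicalSpace X] : Prop :=
  ∀ x : X, CwpPoint x

/-- Around any point `x`, a rectifiable space carries a continuous multiplication `p` with right
identity `x` and a continuous left division `q`. -/
theorem RectifiableSpace.exists_mul_div {G : Type*} [TopologicalSpace G]
    (hrec : RectifiableSpace G) (x : G) :
    ∃ p q : G × G → G, Continuous p ∧ Continuous q ∧ (∀ a, p (a, x) = a) ∧
      q (x, x) = x ∧ ∀ a b, p (a, q (a, b)) = b := by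
  obtain ⟨φ, e, hfst, hdiag⟩ := hrec
  have hsymm_fst (z : G × G) : (φ.symm z).1 = z.1 := by
    simpa using (hfst (φ.symm z)).symm
  have hmul (a b : G) : φ.symm (a, (φ (a, b)).2) = (a, b) :=
    φ.symm_apply_eq.2 (Prod.ext (hfst (a, b)).symm rfl)
  have hdiv (a b : G) : φ (a, (φ.symm (a, b)).2) = (a, b) :=
    (φ.symm_apply_eq.1 (Prod.ext (hsymm_fst (a, b)) rfl :
      φ.symm (a, b) = (a, (φ.symm (a, b)).2))).symm
  have hright (a : G) : φ.symm (a, e) = (a, a) := φ.symm_apply_eq.2 (hdiag a).symm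
  refine ⟨fun z => (φ.symm (z.1, (φ (x, z.2)).2)).2,
    fun z => (φ.symm (x, (φ z).2)).2, by fun_prop, by fun_prop, ?_, ?_, ?_⟩
  · intro a
    simp [hdiag, hright]
  · simp [hdiag, hright]
  · intro a b
    simp [hdiv, hmul]

/-- One step in the construction of the neighborhoods whose intersection witnesses the Moscow
property. -/
theorem exists_open_refinement {G : Type*} [TopologicalSpace G] [RegularSpace G] {x : G}
    {p q : G × G → G} (hp : Continuous p) (hq : Continuous q) (hpx : ∀ a, p (a, x) = a)
    (hqx : q (x, x) = x) {U A : Set G} (hU : IsOpen U) (hAU : A ⊆ U) (hxA : x ∈ closure A)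
    {V : Set G} (hV : IsOpen V) (hxV : x ∈ V) :
    ∃ W O : Set G, IsOpen W ∧ x ∈ W ∧ closure W ⊆ V ∧ (∀ a ∈ W, ∀ b ∈ W, q (a, b) ∈ V) ∧
      IsOpen O ∧ O ⊆ V ∧ (O ∩ A).Nonempty ∧ ∀ b ∈ O, ∀ y ∈ W, p (b, y) ∈ U := by
  obtain ⟨a, haV, haA⟩ := mem_closure_iff.1 hxA V hV hxV
  obtain ⟨O, N, hO, hN, haO, hxN, hON⟩ := isOpen_prod_iff.1 (hU.preimage hp) a x
    (by simpa [hpx] using hAU haA)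
  obtain ⟨M, M', hM, hM', hxM, hxM', hMM'⟩ := isOpen_prod_iff.1 (hV.preimage hq) x x
    (by simpa [hqx] using hxV)
  obtain ⟨C, hC, hCclosed, hCV⟩ := exists_mem_nhds_isClosed_subset (hV.mem_nhds hxV)
  refine ⟨interior C ∩ (N ∩ (M ∩ M')), O ∩ V,
    isOpen_interior.inter (hN.inter (hM.inter hM')),
    ⟨mem_interior_iff_mem_nhds.2 hC, hxN, hxM, hxM'⟩, ?_, ?_, hO.inter hV,
    inter_subset_right, ⟨a, ⟨haO, haV⟩, haA⟩, ?_⟩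
  · exact (closure_minimal (inter_subset_left.trans interior_subset) hCclosed).trans hCV
  · exact fun a ha b hb => hMM' ⟨ha.2.2.1, hb.2.2.2⟩
  · exact fun b hb y hy => hON ⟨hb.1, hy.2.1⟩

/-- If a rectifiable space is pointwise canonically weakly pseudocompact, then
it is a Moscow space. -/
theorem rectifiable_pcwp_moscow {G : Type*} [TopologicalSpace G] [T1Space G]
    [RegularSpace G] (hrec : RectifiableSpace G)
    (hp : PointwiseCanonicallyWeaklyPseudocompact G) :
    MoscowSpace G := by
  intro U₀ hU₀ x hx
  obtain ⟨p, q, hpc, hqc, hpx, hqx, hpq⟩ := hrec.exists_mul_div x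
  obtain ⟨U, hU, hUreg, hxU, hUU₀⟩ : ∃ U : Set G, IsOpen U ∧ U = interior (closure U) ∧
      x ∈ closure U ∧ closure U ⊆ closure U₀ :=
    ⟨interior (closure U₀), isOpen_interior, interior_closure_idem.symm,
      closure_mono hU₀.subset_interior_closure hx,
      closure_minimal interior_subset isClosed_closure⟩
  obtain ⟨A, hAU, hxA, hacc⟩ := hp x U hUreg hxU
  have hstep (n : ℕ) (V : {V : Set G // IsOpen V ∧ x ∈ V}) :=
    exists_open_refinement hpc hqc hpx hqx hU (hAU n) (hxA n) V.2.1 V.2.2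
  choose W O hW hxW hWcl hWq hO hOV hOA hOU using hstep
  let V : ℕ → {V : Set G // IsOpen V ∧ x ∈ V} := fun n =>
    Nat.rec ⟨univ, isOpen_univ, mem_univ x⟩ (fun n V => ⟨W n V, hW n V, hxW n V⟩) n
  have hanti : Antitone fun n => (V n).1 := by
    refine antitone_nat_of_succ_le fun n => ?_
    exact subset_closure.trans (hWcl n (V n))
  obtain ⟨z, hz⟩ := hacc (fun n => O n (V n)) (fun n => hO n _) (fun n => hOA n _)
  have hzV (n : ℕ) : z ∈ (V n).1 := by
    refine hWcl n (V n) (mem_closure_iff_nhds.2 fun N hN => ?_)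
    obtain ⟨m, ⟨b, hbN, hbO⟩, hm⟩ := (hz N hN).exists_gt n
    exact ⟨b, hbN, hanti (Nat.succ_le_of_lt hm) (hOV m _ hbO)⟩
  refine ⟨⋂ n, (V n).1, .iInter_of_isOpen fun n => (V n).2.1,
    mem_iInter.2 fun n => (V n).2.2, fun w hw => hUU₀ ?_⟩
  rw [mem_iInter] at hw
  have hy (n : ℕ) : q (z, w) ∈ (V n).1 := hWq n (V n) z (hzV (n + 1)) w (hw (n + 1))
  rw [← hpq z w]
  refine mem_closure_iff_nhds.2 fun N hN => ?_
  have hcont : Continuous fun b => p (b, q (z, w)) := by fun_prop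
  obtain ⟨m, b, hbN, hbO⟩ := (hz _ (hcont.continuousAt.preimage_mem_nhds hN)).nonempty
  exact ⟨_, hbN, hOU m _ b hbO _ (hy (m + 1))⟩
end

section
/- Let G be a pointwise canonically weakly pseudocompact rectifiable space, and let Y be a Gδ-dense subspace of G. Then Y is C-embedded in G, i.e., every continuous real-valued function on Y extends continuously over G. -/
open Filter Topology Set

/-- A rectifiable space carries a continuous Maltsev operation. -/
theorem RectifiableSpace.exists_malcev {G : Type*} [TopologicalSpace G]
    (hrec : RectifiableSpace G) :
    ∃ M : G × G × G → G, Continuous M ∧ (∀ x y, M (x, y, y) = x) ∧ ∀ x y, M (x, x, y) = y := by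
  obtain ⟨φ, e, hφ, hd⟩ := hrec
  refine ⟨fun t => (φ.symm (t.1, (φ t.2).2)).2, by fun_prop, fun x y => ?_, fun x y => ?_⟩
  · have h : φ.symm (x, e) = (x, x) := by rw [← hd x, φ.symm_apply_apply]
    simp [hd, h]
  · have h : (x, (φ (x, y)).2) = φ (x, y) := Prod.ext (hφ (x, y)).symm rfl
    simp [h]

/-- In a regular space with a continuous Maltsev operation, the closure of a regular open set
contains, together with each of its cwp-points, a Gδ-set around that point. -/
theorem CwpPoint.exists_isGδ_subset_closure {G : Type*} [TopologicalSpace G] [RegularSpace G]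
    {M : G × G × G → G} (hM : Continuous M) (hM₁ : ∀ x y, M (x, y, y) = x)
    (hM₂ : ∀ x y, M (x, x, y) = y) {x : G} (hx : CwpPoint x) {U : Set G}
    (hU : U = interior (closure U)) (hxU : x ∈ closure U) :
    ∃ P : Set G, IsGδ P ∧ x ∈ P ∧ P ⊆ closure U := by
  obtain ⟨A, hAU, hxA, hacc⟩ := hx U hU hxU
  have hUo : IsOpen U := hU ▸ isOpen_interior
  have step : ∀ (n : ℕ) (V : {V : Set G // IsOpen V ∧ x ∈ V}),
      ∃ (O : Set G) (V' : {V : Set G // IsOpen V ∧ x ∈ V}),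
        IsOpen O ∧ (O ∩ A n).Nonempty ∧ O ⊆ V.1 ∧ closure V'.1 ⊆ V.1 ∧
        ∀ o ∈ O, ∀ z ∈ V'.1, ∀ w ∈ V'.1, M (o, z, w) ∈ U := by
    rintro n ⟨V, hVo, hxV⟩
    obtain ⟨a, haV, haA⟩ := mem_closure_iff.1 (hxA n) V hVo hxV
    have hpre : M ⁻¹' U ∈ 𝓝 (a, x, x) :=
      (hUo.preimage hM).mem_nhds (by simpa [hM₁] using hAU n haA)
    rw [nhds_prod_eq, nhds_prod_eq] at hpre
    obtain ⟨O, hO, W, hW, hOW⟩ := mem_prod_iff.1 hpre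
    obtain ⟨W', hW', hWW⟩ := mem_prod_same_iff.1 hW
    obtain ⟨C, hC, hCc, hCV⟩ :=
      exists_mem_nhds_isClosed_subset (inter_mem hW' (hVo.mem_nhds hxV))
    refine ⟨interior O ∩ V, ⟨interior C, isOpen_interior, mem_interior_iff_mem_nhds.2 hC⟩,
      isOpen_interior.inter hVo, ⟨a, ⟨mem_interior_iff_mem_nhds.2 hO, haV⟩, haA⟩,
      inter_subset_right, ?_, ?_⟩
    · exact (closure_minimal interior_subset hCc).trans (hCV.trans inter_subset_right)
    · intro o ho z hz w hw
      exact hOW (mk_mem_prod (interior_subset ho.1) (hWW (mk_mem_prod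
        (hCV (interior_subset hz)).1 (hCV (interior_subset hw)).1)))
  choose O N hOo hOA hOV hNV hMU using step
  let V : ℕ → {V : Set G // IsOpen V ∧ x ∈ V} :=
    fun n => Nat.rec ⟨univ, isOpen_univ, mem_univ x⟩ (fun k W => N k W) n
  have hVanti : Antitone fun n => (V n).1 :=
    antitone_nat_of_succ_le fun n => subset_closure.trans (hNV n (V n))
  obtain ⟨z, hz⟩ := hacc (fun n => O n (V n)) (fun n => hOo n _) (fun n => hOA n _)
  have hzV : ∀ n, z ∈ (V n).1 := by
    refine fun n => hNV n (V n) (mem_closure_iff_nhds.2 fun T hT => ?_)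
    obtain ⟨m, ⟨t, htT, htO⟩, hm⟩ := (hz T hT).exists_gt n
    exact ⟨t, htT, hVanti (Nat.succ_le_of_lt hm) (hOV m _ htO)⟩
  refine ⟨⋂ n, (V n).1, .iInter fun n => (V n).2.1.isGδ, mem_iInter.2 fun n => (V n).2.2, ?_⟩
  refine fun w hw => mem_closure_iff_nhds.2 fun T hT => ?_
  have hcont : Continuous fun o => M (o, z, w) := by fun_prop
  have hpre : (fun o => M (o, z, w)) ⁻¹' T ∈ 𝓝 z :=
    hcont.continuousAt.preimage_mem_nhds (by simpa [hM₂] using hT)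
  obtain ⟨m, t, htT, htO⟩ := (hz _ hpre).nonempty
  exact ⟨_, htT, hMU m (V m) t htO z (hzV (m + 1)) w (mem_iInter.1 hw (m + 1))⟩

/-- A space is Moscow if the closure of every open set is a union of Gδ-sets. -/
def IsMoscow (X : Type*) [TopologicalSpace X] : Prop :=
  ∀ U : Set X, IsOpen U → ∀ x ∈ closure U, ∃ P : Set X, IsGδ P ∧ x ∈ P ∧ P ⊆ closure U

theorem RectifiableSpace.isMoscow {G : Type*} [TopologicalSpace G] [RegularSpace G]
    (hrec : RectifiableSpace G) (hp : PointwiseCanonicallyWeaklyPseudocompact G) :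
    IsMoscow G := by
  obtain ⟨M, hM, hM₁, hM₂⟩ := hrec.exists_malcev
  intro U hU x hx
  have hcl : closure (interior (closure U)) = closure U :=
    (closure_minimal interior_subset isClosed_closure).antisymm
      (closure_mono hU.subset_interior_closure)
  rw [← hcl] at hx ⊢
  exact (hp x).exists_isGδ_subset_closure hM hM₁ hM₂ (by rw [hcl]) hx

/-- A continuous function on a Gδ-dense subspace of a Moscow space does not oscillate across an
interval `(a, b)` near any point of the space. -/
theorem IsMoscow.not_frequently_lt_and_frequently_gt {X : Type*} [TopologicalSpace X] (hX : IsMoscow X)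
    {Y : Set X} (hY : ∀ P : Set X, IsGδ P → P.Nonempty → (P ∩ Y).Nonempty)
    {f : Y → ℝ} (hf : Continuous f) (x : X) {a b : ℝ} (hab : a < b) :
    ¬((∃ᶠ y in comap ((↑) : Y → X) (𝓝 x), f y < a) ∧
      ∃ᶠ y in comap ((↑) : Y → X) (𝓝 x), b < f y) := by
  have hYd : Dense Y := dense_iff_inter_open.2 fun U hU hne => hY U hU.isGδ hne
  have key : ∀ S : Set ℝ, IsOpen S → (∃ᶠ y in comap ((↑) : Y → X) (𝓝 x), f y ∈ S) →
      ∃ P : Set X, IsGδ P ∧ x ∈ P ∧ ∀ y : Y, (y : X) ∈ P → f y ∈ closure S := by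
    intro S hS hfr
    obtain ⟨U, hU, hUS⟩ := isOpen_induced_iff.1 (hS.preimage hf)
    have hxU : x ∈ closure U := by
      refine mem_closure_iff_nhds.2 fun T hT => ?_
      obtain ⟨y, hyS, hyT⟩ := (hfr.and_eventually (preimage_mem_comap hT)).exists
      exact ⟨y, hyT, (hUS.symm ▸ hyS : y ∈ ((↑) : Y → X) ⁻¹' U)⟩
    obtain ⟨P, hP, hxP, hPU⟩ := hX U hU x hxU
    refine ⟨P, hP, hxP, fun y hy => ?_⟩
    have hy' : y ∈ closure (f ⁻¹' S) := by
      rw [closure_subtype, ← hUS, Subtype.image_preimage_coe, inter_comm]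
      exact closure_minimal (hYd.open_subset_closure_inter hU) isClosed_closure (hPU hy)
    exact hf.closure_preimage_subset S hy'
  rintro ⟨ha, hb⟩
  obtain ⟨P, hP, hxP, hPa⟩ := key (Iio a) isOpen_Iio ha
  obtain ⟨Q, hQ, hxQ, hQb⟩ := key (Ioi b) isOpen_Ioi hb
  obtain ⟨y, ⟨hyP, hyQ⟩, hyY⟩ := hY (P ∩ Q) (hP.inter hQ) ⟨x, hxP, hxQ⟩
  have hya := hPa ⟨y, hyY⟩ hyP
  have hyb := hQb ⟨y, hyY⟩ hyQ
  rw [closure_Iio, mem_Iic] at hya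
  rw [closure_Ioi, mem_Ici] at hyb
  linarith

/-- A Gδ-dense subspace of a Moscow space is C-embedded. -/
theorem IsMoscow.exists_continuous_extension {X : Type*} [TopologicalSpace X] (hX : IsMoscow X)
    {Y : Set X} (hY : ∀ P : Set X, IsGδ P → P.Nonempty → (P ∩ Y).Nonempty)
    {f : Y → ℝ} (hf : Continuous f) :
    ∃ g : X → ℝ, Continuous g ∧ ∀ y : Y, g y = f y := by
  have hYd : Dense Y := dense_iff_inter_open.2 fun U hU hne => hY U hU.isGδ hne
  have hdi : IsDenseInducing ((↑) : Y → X) := hYd.isDenseEmbedding_val.isDenseInducing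
  refine ⟨hdi.extend f, hdi.continuous_extend fun x => ?_, fun y => hdi.extend_eq hf y⟩
  have hbdd : ∀ h : Y → ℝ, ∃ c, ∃ᶠ y in comap ((↑) : Y → X) (𝓝 x), h y ≤ c := by
    intro h
    by_contra! hc
    have hn : ∀ n : ℕ, ∃ W : Set X, IsOpen W ∧ x ∈ W ∧ ∀ y : Y, (y : X) ∈ W → (n : ℝ) < h y := by
      intro n
      obtain ⟨T, hT, hTn⟩ := mem_comap.1 (hc n)
      obtain ⟨W, hWT, hW, hxW⟩ := mem_nhds_iff.1 hT
      exact ⟨W, hW, hxW, fun y hy => hTn (hWT hy)⟩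
    choose W hWo hxW hW using hn
    obtain ⟨y, hyW, hyY⟩ := hY (⋂ n, W n) (.iInter fun n => (hWo n).isGδ) ⟨x, mem_iInter.2 hxW⟩
    obtain ⟨n, hn⟩ := exists_nat_gt (h ⟨y, hyY⟩)
    exact (hn.trans (hW n ⟨y, hyY⟩ (mem_iInter.1 hyW n))).false
  have hosc : ∀ a b : ℝ, a < b → ¬((∃ᶠ y in comap ((↑) : Y → X) (𝓝 x), f y < a) ∧
      ∃ᶠ y in comap ((↑) : Y → X) (𝓝 x), b < f y) :=
    fun a b => hX.not_frequently_lt_and_frequently_gt hY hf x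
  refine tendsto_of_no_upcrossings dense_univ (fun a _ b _ => hosc a b) ?_ ?_
  · obtain ⟨c, hc⟩ := hbdd f
    have h := fun hb => hosc (c + 1) (c + 2) (by linarith)
      ⟨hc.mono fun y hy => hy.trans_lt (lt_add_one c), hb⟩
    exact ⟨c + 2, eventually_map.2 ((not_frequently.1 h).mono fun y => le_of_not_gt)⟩
  · obtain ⟨c, hc⟩ := hbdd (-f)
    have h := fun ha => hosc (-c - 2) (-c - 1) (by linarith)
      ⟨ha, hc.mono fun y hy => by rw [Pi.neg_apply] at hy; linarith⟩
    exact ⟨-c - 2, eventually_map.2 ((not_frequently.1 h).mono fun y => le_of_not_gt)⟩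

/-- Let `G` be a pointwise canonically weakly pseudocompact rectifiable space,
and let `Y` be a Gδ-dense subspace of `G` (every nonempty Gδ-set of `G` meets
`Y`). Then `Y` is C-embedded in `G`: every continuous real-valued function on
`Y` extends to a continuous real-valued function on `G`. -/
theorem rectifiable_pcwp_gdeltaDense_cEmbedded {G : Type*} [TopologicalSpace G]
    [T1Space G] [RegularSpace G] (hrec : RectifiableSpace G)
    (hp : PointwiseCanonicallyWeaklyPseudocompact G)
    (Y : Set G) (hY : ∀ P : Set G, IsGδ P → P.Nonempty → (P ∩ Y).Nonempty) :
    ∀ f : Y → ℝ, Continuous f → ∃ g : G → ℝ, Continuous g ∧ ∀ y : Y, g y = f y := by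
  exact fun _ hf => (hrec.isMoscow hp).exists_continuous_extension hY hf
end

section
/- Every rectifiable space of countable g-tightness is a Moscow space. -/
open Filter Topology Set

/-- A subset `A` of `G` is ω-deep in `U` (relative to the rectifiable
multiplication `p` and the right neutral element `e`) if there is a Gδ-set `B`
in `G` with `e ∈ B` and `A · B = p '' (A ×ˢ B) ⊆ U`. -/
def OmegaDeep {G : Type*} [TopologicalSpace G] (p : G × G → G) (e : G)
    (U A : Set G) : Prop :=
  ∃ B : Set G, IsGδ B ∧ e ∈ B ∧ p '' (A ×ˢ B) ⊆ U

/-- Every rectifiable space of countable g-tightness is a Moscow space. Here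
`G` is rectifiable via the homeomorphism `φ` with right neutral element `e`,
`p = π₂ ∘ φ⁻¹`, and `G` has countable g-tightness: for each regular open
`U ⊆ G` and each `x ∈ closure U` there is an ω-deep subset `A` of `U` with
`x ∈ closure A`. -/
theorem rectifiable_countable_gTightness_moscow {G : Type*} [TopologicalSpace G]
    [T1Space G] [RegularSpace G]
    (φ : G × G ≃ₜ G × G) (e : G)
    (hφ₁ : ∀ z : G × G, (φ z).1 = z.1) (hφ₂ : ∀ x : G, φ (x, x) = (x, e))
    (hgt : ∀ U : Set G, U = interior (closure U) → ∀ x ∈ closure U,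
      ∃ A : Set G, OmegaDeep (fun z => (φ.symm z).2) e U A ∧ x ∈ closure A) :
    MoscowSpace G := by
  intro U hU x hx
  have hreg : closure (interior (closure U)) = closure U :=
    (closure_minimal interior_subset isClosed_closure).antisymm
      (closure_mono hU.subset_interior_closure)
  obtain ⟨A, ⟨B, hB, heB, hAB⟩, hxA⟩ :=
    hgt (interior (closure U)) (by rw [hreg]) x (by rwa [hreg])
  refine ⟨(fun y => (φ (x, y)).2) ⁻¹' B, hB.preimage (by fun_prop), ?_, fun y hy => ?_⟩
  · simpa [hφ₂] using heB
  · have hcont : Continuous fun a => (φ.symm (a, (φ (x, y)).2)).2 := by fun_prop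
    have hval : (φ.symm (x, (φ (x, y)).2)).2 = y := by
      have hpair : (x, (φ (x, y)).2) = φ (x, y) := Prod.ext (hφ₁ (x, y)).symm rfl
      rw [hpair, φ.symm_apply_apply]
    have hmaps : MapsTo (fun a => (φ.symm (a, (φ (x, y)).2)).2) A (closure U) :=
      fun a ha => interior_subset (hAB (mem_image_of_mem _ (mk_mem_prod ha hy)))
    exact hval ▸ hmaps.closure_left hcont isClosed_closure hxA
end

section
/- If G is a rectifiable space of countable tightness, then the g-tightness of G is countable. -/
open Filter Topology Set

/-- If a rectifiable space `G` (rectified by `φ` with right neutral element `e`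
and `p = π₂ ∘ φ⁻¹`) has countable tightness, then the g-tightness of `G` is
countable: for each regular open `U ⊆ G` and each `x ∈ closure U` there is an
ω-deep subset `A` of `U` with `x ∈ closure A`. -/
theorem rectifiable_countable_tightness_gTightness {G : Type*} [TopologicalSpace G]
    [T1Space G] [RegularSpace G]
    (φ : G × G ≃ₜ G × G) (e : G)
    (hφ₁ : ∀ z : G × G, (φ z).1 = z.1) (hφ₂ : ∀ x : G, φ (x, x) = (x, e))
    (ht : ∀ (A : Set G) (x : G), x ∈ closure A →
      ∃ C : Set G, C ⊆ A ∧ C.Countable ∧ x ∈ closure C) :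
    ∀ U : Set G, U = interior (closure U) → ∀ x ∈ closure U,
      ∃ A : Set G, OmegaDeep (fun z => (φ.symm z).2) e U A ∧ x ∈ closure A := by
  intro U hU x hx
  have hUo : IsOpen U := hU ▸ isOpen_interior
  obtain ⟨C, hCU, hC, hxC⟩ := ht U x hx
  refine ⟨C, ⟨⋂ c ∈ C, {b | (φ.symm (c, b)).2 ∈ U}, ?_, ?_, ?_⟩, hxC⟩
  · refine IsGδ.biInter_of_isOpen hC fun c _ => hUo.preimage ?_
    fun_prop
  · refine mem_iInter₂.2 fun c hc => ?_
    have hce : φ.symm (c, e) = (c, c) := by rw [← hφ₂ c, φ.symm_apply_apply]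
    simpa [hce] using hCU hc
  · rintro _ ⟨⟨c, b⟩, ⟨hc, hb⟩, rfl⟩
    exact mem_iInter₂.1 hb c hc
end

section
/- If G is a rectifiable space of countable o-tightness, then the g-tightness of G is countable. -/
open Filter Topology Set

/-- If a rectifiable space `G` (rectified by `φ` with right neutral element `e`
and `p = π₂ ∘ φ⁻¹`) has countable o-tightness (whenever a point belongs to the
closure of the union of a family of open sets, it belongs to the closure of the
union of some countable subfamily), then the g-tightness of `G` is countable:
for each regular open `U ⊆ G` and each `x ∈ closure U` there is an ω-deep
subset `A` of `U` with `x ∈ closure A`. -/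
theorem rectifiable_countable_oTightness_gTightness {G : Type*} [TopologicalSpace G]
    [T1Space G] [RegularSpace G]
    (φ : G × G ≃ₜ G × G) (e : G)
    (hφ₁ : ∀ z : G × G, (φ z).1 = z.1) (hφ₂ : ∀ x : G, φ (x, x) = (x, e))
    (hot : ∀ η : Set (Set G), (∀ V ∈ η, IsOpen V) → ∀ a : G, a ∈ closure (⋃₀ η) →
      ∃ ζ ⊆ η, ζ.Countable ∧ a ∈ closure (⋃₀ ζ)) :
    ∀ U : Set G, U = interior (closure U) → ∀ x ∈ closure U,
      ∃ A : Set G, OmegaDeep (fun z => (φ.symm z).2) e U A ∧ x ∈ closure A := by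
  intro U hU x hx
  have hUo : IsOpen U := by rw [hU]; exact isOpen_interior
  have hpe : ∀ y : G, (φ.symm (y, e)).2 = y := fun y => by
    rw [← hφ₂ y, φ.symm_apply_apply]
  have hpc : Continuous fun z : G × G => (φ.symm z).2 := continuous_snd.comp φ.symm.continuous
  let η : Set (Set G) := {V | IsOpen V ∧ ∃ W : Set G, IsOpen W ∧ e ∈ W ∧
    ∀ a ∈ V, ∀ b ∈ W, (φ.symm (a, b)).2 ∈ U}
  have hsub : U ⊆ ⋃₀ η := fun y hy => by
    obtain ⟨V, W, hV, hW, hyV, heW, hVW⟩ := isOpen_prod_iff.1 (hUo.preimage hpc) y e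
      (by simpa only [mem_preimage, hpe] using hy)
    exact ⟨V, ⟨hV, W, hW, heW, fun a ha b hb => hVW (mk_mem_prod ha hb)⟩, hyV⟩
  obtain ⟨ζ, hζη, hζ, hxζ⟩ := hot η (fun V hV => hV.1) x (closure_mono hsub hx)
  choose! W hWo heW hW using fun V (hV : V ∈ ζ) => (hζη hV).2
  refine ⟨⋃₀ ζ, ⟨⋂ V ∈ ζ, W V, .biInter hζ fun V hV => (hWo V hV).isGδ,
    mem_iInter₂.2 heW, ?_⟩, hxζ⟩
  rintro _ ⟨⟨a, b⟩, ⟨⟨V, hV, ha⟩, hb⟩, rfl⟩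
  exact hW V hV a ha b (mem_iInter₂.1 hb V hV)
end

section
/- Let G be a rectifiable space, U a subset of G, and b an element of G. If there exists a countable family γ of ω-deep subsets of U such that b ∈ cl(⋃γ), then there is a closed Gδ-subset P of G such that b ∈ P ⊆ cl(U). -/
open Filter Topology Set

/-- In a regular space, every neighbourhood of a point contains a closed Gδ-set through it. -/
theorem exists_isClosed_isGδ_subset_of_mem_nhds {X : Type*} [TopologicalSpace X] [RegularSpace X]
    {x : X} {W : Set X} (hW : W ∈ 𝓝 x) :
    ∃ P : Set X, IsClosed P ∧ IsGδ P ∧ x ∈ P ∧ P ⊆ W := by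
  have shrink (V : {V : Set X // IsOpen V ∧ x ∈ V}) :
      ∃ V' : {V : Set X // IsOpen V ∧ x ∈ V}, closure V'.1 ⊆ V.1 := by
    obtain ⟨C, hC, hCc, hCV⟩ := exists_mem_nhds_isClosed_subset (V.2.1.mem_nhds V.2.2)
    exact ⟨⟨interior C, isOpen_interior, mem_interior_iff_mem_nhds.2 hC⟩,
      (closure_minimal interior_subset hCc).trans hCV⟩
  choose s hs using shrink
  let V : ℕ → {V : Set X // IsOpen V ∧ x ∈ V} := fun n =>
    s^[n] ⟨interior W, isOpen_interior, mem_interior_iff_mem_nhds.2 hW⟩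
  have hV (n : ℕ) : closure (V (n + 1)).1 ⊆ (V n).1 := by
    simpa only [V, Function.iterate_succ_apply'] using hs (V n)
  have hP : ⋂ n, (V n).1 = ⋂ n, closure (V n).1 :=
    (iInter_mono fun _ => subset_closure).antisymm <|
      subset_iInter fun n => (iInter_subset _ (n + 1)).trans (hV n)
  refine ⟨⋂ n, (V n).1, ?_, .iInter_of_isOpen fun n => (V n).2.1,
    mem_iInter.2 fun n => (V n).2.2, (iInter_subset _ 0).trans interior_subset⟩
  rw [hP]
  exact isClosed_iInter fun _ => isClosed_closure

/-- In a regular space, every Gδ-set contains a closed Gδ-set through each of its points. -/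
theorem IsGδ.exists_isClosed_isGδ_subset {X : Type*} [TopologicalSpace X] [RegularSpace X]
    {x : X} {S : Set X} (hS : IsGδ S) (hx : x ∈ S) :
    ∃ P : Set X, IsClosed P ∧ IsGδ P ∧ x ∈ P ∧ P ⊆ S := by
  obtain ⟨W, hWo, rfl⟩ := hS.eq_iInter_nat
  choose P hPc hPG hxP hPW using fun n =>
    exists_isClosed_isGδ_subset_of_mem_nhds ((hWo n).mem_nhds (mem_iInter.1 hx n))
  exact ⟨⋂ n, P n, isClosed_iInter hPc, .iInter hPG, mem_iInter.2 hxP, iInter_mono hPW⟩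

/-- Let `G` be a rectifiable space (rectified by `φ` with right neutral element
`e` and `p = π₂ ∘ φ⁻¹`), `U` a subset of `G`, and `b ∈ G`. If there exists a
countable family `γ` of ω-deep subsets of `U` such that `b ∈ closure (⋃₀ γ)`,
then there is a closed Gδ-subset `P` of `G` with `b ∈ P ⊆ closure U`. -/
theorem rectifiable_omegaDeep_closed_gdelta {G : Type*} [TopologicalSpace G]
    [T1Space G] [RegularSpace G]
    (φ : G × G ≃ₜ G × G) (e : G)
    (hφ₁ : ∀ z : G × G, (φ z).1 = z.1) (hφ₂ : ∀ x : G, φ (x, x) = (x, e))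
    (U : Set G) (b : G) (γ : Set (Set G)) (hγc : γ.Countable)
    (hγ : ∀ A ∈ γ, OmegaDeep (fun z => (φ.symm z).2) e U A)
    (hb : b ∈ closure (⋃₀ γ)) :
    ∃ P : Set G, IsClosed P ∧ IsGδ P ∧ b ∈ P ∧ P ⊆ closure U := by
  choose! B hBG heB hBU using hγ
  have hB : IsGδ (⋂ A ∈ γ, B A) := .biInter hγc hBG
  have hq : Continuous fun z => (φ (b, z)).2 := by fun_prop
  obtain ⟨P, hPc, hPG, hbP, hPS⟩ := (hB.preimage hq).exists_isClosed_isGδ_subset (x := b)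
    (by simpa [hφ₂] using heB)
  refine ⟨P, hPc, hPG, hbP, fun z hz => ?_⟩
  have hy : ∀ A ∈ γ, (φ (b, z)).2 ∈ B A := by simpa using hPS hz
  have hp : Continuous fun x => (φ.symm (x, (φ (b, z)).2)).2 := by fun_prop
  have hz' : (φ.symm (b, (φ (b, z)).2)).2 = z := by
    have : (b, (φ (b, z)).2) = φ (b, z) := Prod.ext (hφ₁ (b, z)).symm rfl
    rw [this, φ.symm_apply_apply]
  have hmaps : MapsTo (fun x => (φ.symm (x, (φ (b, z)).2)).2) (⋃₀ γ) U := by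
    rintro x ⟨A, hA, hx⟩
    exact hBU A hA ⟨(x, (φ (b, z)).2), ⟨hx, hy A hA⟩, rfl⟩
  simpa only [hz'] using map_mem_closure hp hb hmaps
end

section
/- Let G be a sequential rectifiable space with right neutral element e such that the subspace G \ {e} is normal. Then G has countable pseudocharacter, i.e., every point of G is a Gδ-point. -/
open Filter Topology Set

/-- In a sequential space, a non-isolated point is the limit of a sequence avoiding it. -/
theorem exists_seq_ne_tendsto_of_not_isOpen_singleton {X : Type*} [TopologicalSpace X]
    [SequentialSpace X] {a : X} (ha : ¬ IsOpen ({a} : Set X)) :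
    ∃ u : ℕ → X, (∀ n, u n ≠ a) ∧ Tendsto u atTop (𝓝 a) := by
  by_contra! h
  refine ha (isClosed_compl_iff.1 (IsSeqClosed.isClosed fun u p hu hp hpa => ?_))
  obtain rfl : p = a := hpa
  exact h u hu hp

/-- Let `q` be a continuous binary operation with right identity `e` such that `q e z = e` only for
`z = e`. If `e` is the limit of a nontrivial sequence and its complement is normal, then `e` is a
`Gδ`-point. -/
theorem isGδ_singleton_of_normalSpace_compl {X : Type*} [TopologicalSpace X] [T1Space X]
    [RegularSpace X] {e : X} (q : X → X → X) (hq : Continuous fun p : X × X => q p.1 p.2)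
    (hqe : ∀ x, q x e = x) (hqz : ∀ z, q e z = e → z = e) (hnorm : NormalSpace ({e}ᶜ : Set X))
    {u : ℕ → X} (hu : ∀ n, u n ≠ e) (hlim : Tendsto u atTop (𝓝 e)) :
    IsGδ ({e} : Set X) := by
  have : T3Space X := {}
  have hW (n : ℕ) : ∃ W ∈ 𝓝 e, IsClosed W ∧ W ⊆ {u n}ᶜ :=
    exists_mem_nhds_isClosed_subset (isOpen_compl_singleton.mem_nhds (hu n).symm)
  choose W hWe hWc hWu using hW
  have hA : IsClosed ((↑) ⁻¹' insert e (range u) : Set ({e}ᶜ : Set X)) :=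
    hlim.isCompact_insert_range.isClosed.preimage continuous_subtype_val
  have hB : IsClosed ((↑) ⁻¹' (⋂ n, W n) : Set ({e}ᶜ : Set X)) :=
    (isClosed_iInter hWc).preimage continuous_subtype_val
  obtain ⟨U, V, hU, hV, hAU, hBV, hUV⟩ := normal_separation hA hB <| by
    rw [Set.disjoint_left]
    rintro ⟨x, hx⟩ (hxe | ⟨n, hn⟩) hxW
    · exact hx hxe
    · exact hWu n (mem_iInter.1 hxW n) hn.symm
  have hemb : IsOpenEmbedding ((↑) : ({e}ᶜ : Set X) → X) :=
    isOpen_compl_singleton.isOpenEmbedding_subtypeVal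
  have hUo := hemb.isOpenMap U hU
  have hVo := hemb.isOpenMap V hV
  have hUV' : Disjoint ((↑) '' U : Set X) ((↑) '' V) :=
    (disjoint_image_iff Subtype.val_injective).2 hUV
  have hq₂ (x : X) : Continuous (q x) := hq.comp (by fun_prop : Continuous fun z => (x, z))
  have hq₁ (z : X) : Continuous fun x => q x z := hq.comp (by fun_prop : Continuous fun x => (x, z))
  have hEq : ({e} : Set X) = ⋂ n, (q e ⁻¹' interior (W n) ∩ q (u n) ⁻¹' ((↑) '' U)) := by
    refine Subset.antisymm ?_ fun z hz => ?_
    · rintro _ rfl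
      refine mem_iInter.2 fun n => ⟨?_, ?_⟩
      · simpa only [mem_preimage, hqe] using mem_interior_iff_mem_nhds.2 (hWe n)
      · simp only [mem_preimage, hqe]
        exact ⟨⟨u n, hu n⟩, hAU (Or.inr ⟨n, rfl⟩), rfl⟩
    · rw [mem_iInter] at hz
      by_contra hze
      have hzV : q e z ∈ ((↑) '' V : Set X) :=
        ⟨⟨q e z, fun h => hze (hqz z h)⟩,
          hBV (mem_iInter.2 fun n => interior_subset (hz n).1), rfl⟩
      have htend : Tendsto (fun n => q (u n) z) atTop (𝓝 (q e z)) :=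
        ((hq₁ z).tendsto e).comp hlim
      obtain ⟨n, hn⟩ := (htend.eventually (hVo.mem_nhds hzV)).exists
      exact Set.disjoint_left.1 hUV' (hz n).2 hn
  rw [hEq]
  exact IsGδ.iInter_of_isOpen fun n =>
    (isOpen_interior.preimage (hq₂ e)).inter (hUo.preimage (hq₂ (u n)))

/-- Let `G` be a sequential rectifiable space (rectified by the homeomorphism
`φ` with right neutral element `e`) such that the subspace `G \ {e}` is normal.
Then `G` has countable pseudocharacter: every singleton of `G` is a Gδ-set. -/
theorem sequential_rectifiable_normal_countable_pseudocharacter {G : Type*}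
    [TopologicalSpace G] [T1Space G] [RegularSpace G] [SequentialSpace G]
    (φ : G × G ≃ₜ G × G) (e : G)
    (hφ₁ : ∀ z : G × G, (φ z).1 = z.1) (hφ₂ : ∀ x : G, φ (x, x) = (x, e))
    (hnorm : NormalSpace (({e}ᶜ : Set G))) :
    ∀ x : G, IsGδ ({x} : Set G) := by
  have he : IsGδ ({e} : Set G) := by
    by_cases hopen : IsOpen ({e} : Set G)
    · exact hopen.isGδ
    obtain ⟨u, hu, hlim⟩ := exists_seq_ne_tendsto_of_not_isOpen_singleton hopen
    refine isGδ_singleton_of_normalSpace_compl (fun x z => (φ.symm (x, z)).2)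
      (continuous_snd.comp φ.symm.continuous) (fun x => ?_) (fun z hz => ?_) hnorm hu hlim
    · rw [← hφ₂ x, φ.symm_apply_apply]
    · have h₁ : (φ.symm (e, z)).1 = e := by
        rw [← hφ₁, φ.apply_symm_apply]
      have h₂ : φ.symm (e, z) = (e, e) := Prod.ext h₁ hz
      rw [φ.symm_apply_eq, hφ₂] at h₂
      exact congrArg Prod.snd h₂
  intro x
  have hEq : ({x} : Set G) = (fun y => (φ (x, y)).2) ⁻¹' {e} := by
    ext y
    refine ⟨?_, fun hy => ?_⟩
    · rintro rfl
      simp [hφ₂]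
    · have h : φ (x, y) = φ (x, x) := by
        rw [hφ₂]
        exact Prod.ext (hφ₁ _) hy
      exact congrArg Prod.snd (φ.injective h)
  obtain ⟨f, hf, hfe⟩ := isGδ_iff_eq_iInter_nat.1 he
  rw [hEq, hfe, preimage_iInter]
  exact IsGδ.iInter_of_isOpen fun n => (hf n).preimage (by fun_prop)
end

section
/- Suppose that G is a Tychonoff paratopological group and Y = bG \ G is the remainder of G in some Hausdorff compactification bG of G. If Y has countable pseudocharacter, then at least one of the following holds: (1) G is of countable type; (2) Y is first-countable. -/
open Filter Topology Set

/-- A space `X` is of countable type if every compact subspace `F` of `X` is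
contained in a compact subspace `K ⊆ X` that has a countable base of open
neighborhoods in `X`. -/
def CountableType (X : Type*) [TopologicalSpace X] : Prop :=
  ∀ F : Set X, IsCompact F → ∃ K : Set X, IsCompact K ∧ F ⊆ K ∧
    ∃ B : ℕ → Set X, (∀ n, IsOpen (B n) ∧ K ⊆ B n) ∧
      ∀ V : Set X, IsOpen V → K ⊆ V → ∃ n, B n ⊆ V

open scoped Pointwise

/-- In a compact Hausdorff space, every point of a Gδ set lies in a closed subset of it which has
a countable base of open neighborhoods. -/
theorem IsGδ.exists_isClosed_countable_base {X : Type*} [TopologicalSpace X] [CompactSpace X]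
    [T2Space X] {S : Set X} (hS : IsGδ S) {x : X} (hx : x ∈ S) :
    ∃ C : Set X, IsClosed C ∧ x ∈ C ∧ C ⊆ S ∧
      ∃ B : ℕ → Set X, (∀ n, IsOpen (B n) ∧ C ⊆ B n) ∧
        ∀ V : Set X, IsOpen V → C ⊆ V → ∃ n, B n ⊆ V := by
  obtain ⟨U, hUo, rfl⟩ := isGδ_iff_eq_iInter_nat.1 hS
  have hxU : ∀ n, x ∈ U n := mem_iInter.1 hx
  have shrink : ∀ W : Set X, IsOpen W → x ∈ W → ∃ O, IsOpen O ∧ x ∈ O ∧ closure O ⊆ W := by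
    intro W hW hxW
    obtain ⟨N, hN, hNc, hNW⟩ := exists_mem_nhds_isClosed_subset (hW.mem_nhds hxW)
    exact ⟨interior N, isOpen_interior, mem_interior_iff_mem_nhds.2 hN,
      (closure_minimal interior_subset hNc).trans hNW⟩
  have next : ∀ (n : ℕ) (O : {O : Set X // IsOpen O ∧ x ∈ O}),
      ∃ O' : {O : Set X // IsOpen O ∧ x ∈ O}, closure O'.1 ⊆ O.1 ∩ U n := by
    rintro n ⟨O, hO, hxO⟩
    obtain ⟨O', h₁, h₂, h₃⟩ := shrink (O ∩ U n) (hO.inter (hUo n)) ⟨hxO, hxU n⟩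
    exact ⟨⟨O', h₁, h₂⟩, h₃⟩
  choose g hg using next
  let B : ℕ → {O : Set X // IsOpen O ∧ x ∈ O} := fun n =>
    Nat.rec ⟨univ, isOpen_univ, mem_univ x⟩ g n
  have hB : ∀ n, closure (B (n + 1)).1 ⊆ (B n).1 ∩ U n := fun n => hg n (B n)
  have hanti : Antitone fun n => (B n).1 :=
    antitone_nat_of_succ_le fun n => subset_closure.trans ((hB n).trans inter_subset_left)
  have hC : ⋂ n, (B n).1 = ⋂ n, closure (B n).1 :=
    subset_antisymm (iInter_mono fun n => subset_closure)
      (subset_iInter fun n => (iInter_subset _ (n + 1)).trans ((hB n).trans inter_subset_left))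
  refine ⟨⋂ n, (B n).1, hC ▸ isClosed_iInter fun n => isClosed_closure,
    mem_iInter.2 fun n => (B n).2.2, ?_, fun n => (B n).1,
    fun n => ⟨(B n).2.1, iInter_subset _ n⟩, fun V hV hCV => ?_⟩
  · exact subset_iInter fun n => (iInter_subset _ (n + 1)).trans
      (subset_closure.trans ((hB n).trans inter_subset_right))
  · obtain ⟨n, hn⟩ := exists_subset_nhds_of_compactSpace (V := fun n => closure (B n).1)
      (Antitone.directed_ge fun m n h => closure_mono (hanti h)) (fun n => isClosed_closure)
      (fun z hz => hV.mem_nhds (hCV (hC ▸ hz)))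
    exact ⟨n, subset_closure.trans hn⟩

/-- A paratopological group containing a nonempty compact set with a countable base of open
neighborhoods is of countable type. -/
theorem CountableType.of_nonempty_isCompact {G : Type*} [Group G] [TopologicalSpace G]
    [ContinuousMul G] {K : Set G} (hK : IsCompact K) (hne : K.Nonempty) {B : ℕ → Set G}
    (hB : ∀ n, IsOpen (B n) ∧ K ⊆ B n)
    (hbase : ∀ V : Set G, IsOpen V → K ⊆ V → ∃ n, B n ⊆ V) : CountableType G := by
  intro F hF
  obtain ⟨k, hk⟩ := hne
  have hF' : IsCompact ((· * k⁻¹) '' F) := hF.image (continuous_mul_const k⁻¹)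
  refine ⟨(· * k⁻¹) '' F * K, hF'.mul hK, fun x hx => ?_, fun n => (· * k⁻¹) '' F * B n,
    fun n => ⟨(hB n).1.mul_left, mul_subset_mul_left (hB n).2⟩, fun V hV hFV => ?_⟩
  · exact ⟨x * k⁻¹, mem_image_of_mem _ hx, k, hk, inv_mul_cancel_right x k⟩
  · obtain ⟨O, W, -, hW, hO, hKW, hOW⟩ := generalized_tube_lemma hF' hK
      (hV.preimage continuous_mul) (fun p hp => hFV (mul_mem_mul hp.1 hp.2))
    obtain ⟨n, hn⟩ := hbase W hW hKW
    refine ⟨n, ?_⟩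
    rintro _ ⟨a, ha, b, hb, rfl⟩
    exact hOW (mk_mem_prod (hO ha) (hn hb))

/-- A Gδ subset of a subspace is the trace of a Gδ subset of the ambient space. -/
theorem IsGδ.exists_eq_preimage_val {X : Type*} [TopologicalSpace X] {Y : Set X} {s : Set Y}
    (hs : IsGδ s) : ∃ S : Set X, IsGδ S ∧ Subtype.val ⁻¹' S = s := by
  obtain ⟨U, hU, rfl⟩ := isGδ_iff_eq_iInter_nat.1 hs
  choose V hV hVU using fun n => isOpen_induced_iff.1 (hU n)
  exact ⟨⋂ n, V n, .iInter_of_isOpen hV, by simp only [preimage_iInter, hVU]⟩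

/-- Suppose `G` is a Tychonoff paratopological group and `Y = bG \ G` is the
remainder of `G` in a Hausdorff compactification `bG` of `G` (here `G` is
embedded densely into the compact Hausdorff space `bG` via `f`). If `Y` has
countable pseudocharacter (every singleton of `Y` is a Gδ-set in `Y`), then
`G` is of countable type or `Y` is first-countable. -/
theorem remainder_countable_pseudocharacter {G bG : Type*}
    [Group G] [TopologicalSpace G] [ContinuousMul G] [T35Space G]
    [TopologicalSpace bG] [CompactSpace bG] [T2Space bG]
    (f : G → bG) (hf : Topology.IsEmbedding f) (hd : DenseRange f)
    (hY : ∀ y : ((Set.range f)ᶜ : Set bG), IsGδ ({y} : Set ((Set.range f)ᶜ : Set bG))) :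
    CountableType G ∨ FirstCountableTopology ((Set.range f)ᶜ : Set bG) := by
  by_cases h : ∀ y : ((Set.range f)ᶜ : Set bG), IsGδ ({y.1} : Set bG)
  · refine Or.inr ⟨fun y => ?_⟩
    obtain ⟨C, -, hyC, hCy, B, hB, hbase⟩ :=
      (h y).exists_isClosed_countable_base (mem_singleton y.1)
    have hb : (𝓝 y.1).HasBasis (fun _ : ℕ => True) B := by
      refine ⟨fun t => ⟨fun ht => ?_, fun ⟨n, _, hn⟩ => ?_⟩⟩
      · obtain ⟨V, hVt, hV, hyV⟩ := mem_nhds_iff.1 ht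
        obtain ⟨n, hn⟩ := hbase V hV (hCy.trans (singleton_subset_iff.2 hyV))
        exact ⟨n, trivial, hn.trans hVt⟩
      · exact mem_of_superset ((hB n).1.mem_nhds ((hB n).2 hyC)) hn
    have : (𝓝 y.1).IsCountablyGenerated := hb.isCountablyGenerated
    rw [nhds_subtype]
    infer_instance
  · left
    push Not at h
    obtain ⟨y, hy⟩ := h
    obtain ⟨S, hS, hSy⟩ := (hY y).exists_eq_preimage_val
    have hyS : y.1 ∈ S := by
      have : y ∈ Subtype.val ⁻¹' S := hSy ▸ mem_singleton y
      exact this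
    obtain ⟨x, hxS, hxy⟩ : ∃ x ∈ S, x ≠ y.1 := by
      by_contra! hc
      exact hy ((Subset.antisymm hc (singleton_subset_iff.2 hyS) : S = {y.1}) ▸ hS)
    have hrange : S ∩ {y.1}ᶜ ⊆ range f := by
      rintro z ⟨hzS, hzy⟩
      by_contra hz
      have : (⟨z, hz⟩ : ((Set.range f)ᶜ : Set bG)) ∈ Subtype.val ⁻¹' S := hzS
      rw [hSy] at this
      exact hzy (congrArg Subtype.val this)
    obtain ⟨C, hC, hxC, hCS, B, hB, hbase⟩ :=
      (hS.inter isOpen_compl_singleton.isGδ).exists_isClosed_countable_base ⟨hxS, hxy⟩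
    have hCf : C ⊆ range f := hCS.trans hrange
    obtain ⟨a, rfl⟩ := hCf hxC
    refine CountableType.of_nonempty_isCompact (K := f ⁻¹' C) (B := fun n => f ⁻¹' B n)
      (hf.isInducing.isCompact_preimage' hC.isCompact hCf) ⟨a, hxC⟩
      (fun n => ⟨(hB n).1.preimage hf.continuous, preimage_mono (hB n).2⟩) fun V hV hCV => ?_
    obtain ⟨W, hW, rfl⟩ := hf.isInducing.isOpen_iff.1 hV
    obtain ⟨n, hn⟩ := hbase W hW fun z hz => by
      obtain ⟨b, rfl⟩ := hCf hz
      exact hCV hz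
    exact ⟨n, preimage_mono hn⟩
end

section
/- Suppose that G is a non-locally compact, k-gentle Tychonoff paratopological group, and Y = bG \ G is the remainder of G in some Hausdorff compactification bG of G. If Y locally has a regular Gδ-diagonal, then G is a topological group, and G, bG and Y are separable and metrizable spaces. -/
open Filter Topology Set

/-- A space `Z` has a regular Gδ-diagonal if the diagonal of `Z` can be
represented as the intersection of the closures of a countable family of open
neighborhoods of the diagonal in `Z × Z`. -/
def HasRegularGDeltaDiagonal (Z : Type*) [TopologicalSpace Z] : Prop :=
  ∃ O : ℕ → Set (Z × Z), (∀ n, IsOpen (O n) ∧ Set.diagonal Z ⊆ O n) ∧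
    Set.diagonal Z = ⋂ n, closure (O n)

/-- A trace on the ambient space `X` of the property that the subspace `S` locally has a regular
Gδ-diagonal: locally, the points of `S` are separated by the closures in `X × X` of a decreasing
sequence of open sets containing the diagonal of `S`. -/
def LocallySeparatesDiagonal {X : Type*} [TopologicalSpace X] (S : Set X) : Prop :=
  ∀ y ∈ S, ∃ U : Set X, IsOpen U ∧ y ∈ U ∧ ∃ O : ℕ → Set (X × X), Antitone O ∧
    (∀ n, IsOpen (O n)) ∧ (∀ n, ∀ x ∈ U ∩ S, (x, x) ∈ O n) ∧
    ∀ x ∈ U ∩ S, ∀ z ∈ U ∩ S, x ≠ z → ∃ n, (x, z) ∉ closure (O n)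

/-- Every sequence of nonempty open sets of `X` clusters at some point of `S`. -/
def IsFeeblyCompactIn {X : Type*} [TopologicalSpace X] (S : Set X) : Prop :=
  ∀ W : ℕ → Set X, (∀ n, IsOpen (W n)) → (∀ n, (W n).Nonempty) →
    ∃ y ∈ S, ∀ N ∈ 𝓝 y, ∃ᶠ n in atTop, (N ∩ W n).Nonempty

section Topological

variable {X : Type*} [TopologicalSpace X] {S : Set X}

lemma locallySeparatesDiagonal_of_hasRegularGDeltaDiagonal (hS : Dense S)
    (hY : ∀ y : S, ∃ U : Set S, IsOpen U ∧ y ∈ U ∧ HasRegularGDeltaDiagonal (closure U)) :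
    LocallySeparatesDiagonal S := by
  intro y hy
  obtain ⟨U, hUo, hyU, hreg⟩ := hY ⟨y, hy⟩
  obtain ⟨V, hVo, rfl⟩ := isOpen_induced_iff.1 hUo
  set Z := closure ((Subtype.val : S → X) ⁻¹' V)
  obtain ⟨O, hO, hdiag⟩ := hreg
  have hι : IsEmbedding (fun z : Z => ((z : S) : X)) :=
    IsEmbedding.subtypeVal.comp IsEmbedding.subtypeVal
  have mk : ∀ x ∈ V ∩ S, ∃ z : Z, ((z : S) : X) = x := fun x hx =>
    ⟨⟨⟨x, hx.2⟩, subset_closure hx.1⟩, rfl⟩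
  let Q : ℕ → Set (X × X) := fun k =>
    interior {p | ∀ a b : Z, ((a : S) : X) = p.1 → ((b : S) : X) = p.2 → (a, b) ∈ O k}
  refine ⟨V, hVo, hyU, fun n => ⋂ k ∈ Iic n, Q k, ?_, ?_, ?_, ?_⟩
  · intro m n hmn
    exact biInter_subset_biInter_left (Iic_subset_Iic.2 hmn)
  · exact fun n => (finite_Iic n).isOpen_biInter fun k _ => isOpen_interior
  · intro n x hx
    refine mem_iInter₂.2 fun k _ => ?_
    obtain ⟨z, rfl⟩ := mk x hx
    have hz : O k ∈ 𝓝 (z, z) := (hO k).1.mem_nhds ((hO k).2 rfl)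
    rw [nhds_prod_eq, hι.nhds_eq_comap, prod_comap_comap_eq] at hz
    obtain ⟨t, ht, hts⟩ := hz
    rw [← nhds_prod_eq] at ht
    refine mem_interior_iff_mem_nhds.2 (mem_of_superset ht ?_)
    rintro ⟨p, q⟩ hpq a b rfl rfl
    exact hts hpq
  · intro x hx z hz hxz
    obtain ⟨a, rfl⟩ := mk x hx
    obtain ⟨b, rfl⟩ := mk z hz
    have hab : (a, b) ∉ ⋂ n, closure (O n) := by
      rw [← hdiag]
      rintro (h : a = b)
      exact hxz (by rw [h])
    obtain ⟨n, hn⟩ := not_forall.1 (fun h => hab (mem_iInter.2 h))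
    refine ⟨n, fun hcl => ?_⟩
    have hz : (O n)ᶜ ∈ 𝓝 (a, b) := by
      rw [mem_closure_iff_frequently, not_frequently] at hn
      exact hn
    rw [nhds_prod_eq, hι.nhds_eq_comap, hι.nhds_eq_comap, prod_comap_comap_eq] at hz
    obtain ⟨t, ht, hts⟩ := hz
    rw [← nhds_prod_eq] at ht
    have hVV : V ×ˢ V ∈ 𝓝 (((a : S) : X), ((b : S) : X)) :=
      prod_mem_nhds (hVo.mem_nhds hx.1) (hVo.mem_nhds hz.1)
    obtain ⟨t', ht't, ht'o, ht'm⟩ := mem_nhds_iff.1 (inter_mem ht hVV)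
    have hne := mem_closure_iff.1 hcl t' ht'o ht'm
    obtain ⟨⟨p, q⟩, ⟨hpt, hpQ⟩, hpS⟩ := (hS.prod hS).inter_open_nonempty (t' ∩ Q n)
      (ht'o.inter isOpen_interior)
      (hne.mono (inter_subset_inter_right _ (biInter_subset_of_mem (mem_Iic.2 le_rfl))))
    obtain ⟨hpt1, hpV⟩ := ht't hpt
    obtain ⟨a', rfl⟩ := mk p ⟨hpV.1, hpS.1⟩
    obtain ⟨b', rfl⟩ := mk q ⟨hpV.2, hpS.2⟩
    exact hts (show (a', b') ∈ _ from hpt1) (interior_subset hpQ a' b' rfl rfl)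

lemma exists_open_closure_subset [RegularSpace X] {U : Set X} {x : X} (h : U ∈ 𝓝 x) :
    ∃ V, IsOpen V ∧ x ∈ V ∧ closure V ⊆ U := by
  obtain ⟨t, ht, htc, htU⟩ := exists_mem_nhds_isClosed_subset h
  exact ⟨interior t, isOpen_interior, mem_interior_iff_mem_nhds.2 ht,
    (closure_minimal interior_subset htc).trans htU⟩

lemma exists_disjoint_prod_of_notMem_closure {O : Set (X × X)} {x z : X}
    (h : (x, z) ∉ closure O) :
    ∃ P R, IsOpen P ∧ x ∈ P ∧ IsOpen R ∧ z ∈ R ∧ ∀ p ∈ P, ∀ r ∈ R, (p, r) ∉ O := by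
  have hz : Oᶜ ∈ 𝓝 (x, z) := by
    rw [mem_closure_iff_frequently, not_frequently] at h
    exact h
  obtain ⟨P, R, hP, hx, hR, hz, hPR⟩ := mem_nhds_prod_iff'.1 hz
  exact ⟨P, R, hP, hx, hR, hz, fun p hp r hr => hPR (mk_mem_prod hp hr)⟩

lemma exists_isGδ_inter_subset [CompactSpace X] [T2Space X] (hd : LocallySeparatesDiagonal S)
    {F : Set X} (hF : IsClosed F) (hFS : F ⊆ S) :
    ∃ T, IsGδ T ∧ F ⊆ T ∧ T ∩ S ⊆ F := by
  suffices ∃ T, IsGδ T ∧ F ∩ F ⊆ T ∧ T ∩ S ⊆ F by simpa using this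
  refine hF.isCompact.induction_on (p := fun s => ∃ T, IsGδ T ∧ F ∩ s ⊆ T ∧ T ∩ S ⊆ F)
    ⟨∅, IsGδ.empty, by simp, by simp⟩ ?_ ?_ ?_
  · rintro s t hst ⟨T, h1, h2, h3⟩
    exact ⟨T, h1, (inter_subset_inter_right _ hst).trans h2, h3⟩
  · rintro s t ⟨T, h1, h2, h3⟩ ⟨T', h1', h2', h3'⟩
    refine ⟨T ∪ T', h1.union h1', ?_, ?_⟩
    · rw [inter_union_distrib_left]
      exact union_subset_union h2 h2'
    · rw [union_inter_distrib_right]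
      exact union_subset h3 h3'
  · intro y hy
    obtain ⟨U, hU, hyU, O, hOa, hOo, hOd, hOs⟩ := hd y (hFS hy)
    obtain ⟨C, hC, hCc, hCU⟩ := exists_mem_nhds_isClosed_subset (hU.mem_nhds hyU)
    refine ⟨C, mem_nhdsWithin_of_mem_nhds hC,
      ⋂ n, {x | x ∈ U ∧ ∃ p ∈ F ∩ C, (p, x) ∈ O n}, ?_, ?_, ?_⟩
    · refine IsGδ.iInter_of_isOpen fun n => hU.inter ?_
      have : {x | ∃ p ∈ F ∩ C, (p, x) ∈ O n} = ⋃ p ∈ F ∩ C, (fun x => (p, x)) ⁻¹' O n := by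
        ext; simp
      change IsOpen {x | ∃ p ∈ F ∩ C, (p, x) ∈ O n}
      rw [this]
      exact isOpen_biUnion fun p _ => (hOo n).preimage (by fun_prop)
    · exact fun x hx => mem_iInter.2 fun n => ⟨hCU hx.2, x, hx, hOd n x ⟨hCU hx.2, hFS hx.1⟩⟩
    · rintro x ⟨hx, hxS⟩
      rw [mem_iInter] at hx
      by_contra hxF
      have key : ∃ n, ∀ p ∈ F ∩ C, (p, x) ∉ O n := by
        refine (hF.inter hCc).isCompact.induction_on (p := fun s => ∃ n, ∀ p ∈ s, (p, x) ∉ O n)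
          ⟨0, by simp⟩ (fun s t hst ⟨n, hn⟩ => ⟨n, fun p hp => hn p (hst hp)⟩) ?_ ?_
        · rintro s t ⟨n, hn⟩ ⟨m, hm⟩
          refine ⟨max n m, fun p hp h => hp.elim (fun hp => hn p hp ?_) (fun hp => hm p hp ?_)⟩
          · exact hOa (le_max_left _ _) h
          · exact hOa (le_max_right _ _) h
        · intro p hp
          obtain ⟨n, hn⟩ := hOs p ⟨hCU hp.2, hFS hp.1⟩ x ⟨(hx 0).1, hxS⟩
            (fun h => hxF (h ▸ hp.1))
          obtain ⟨P, R, hP, hpP, -, hxR, hPR⟩ := exists_disjoint_prod_of_notMem_closure hn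
          exact ⟨P, mem_nhdsWithin_of_mem_nhds (hP.mem_nhds hpP), n, fun q hq => hPR q hq x hxR⟩
      obtain ⟨n, hn⟩ := key
      obtain ⟨-, p, hp, hpx⟩ := hx n
      exact hn p hp hpx

lemma countable_of_pairwise_disjoint_of_locally_finite [CompactSpace X] [T2Space X]
    (hS : Dense S) (hd : LocallySeparatesDiagonal S) {ι : Type*} (W : ι → Set X)
    (hWo : ∀ i, IsOpen (W i)) (hWn : ∀ i, (W i).Nonempty) (hWd : Pairwise (Function.onFun Disjoint W))
    (hWf : ∀ g ∉ S, ∃ N ∈ 𝓝 g, {i | (N ∩ W i).Nonempty}.Finite) : Countable ι := by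
  set F : Set X := {x | ∀ N ∈ 𝓝 x, {i | (N ∩ W i).Nonempty}.Infinite} with hFdef
  have hcompl : ∀ x ∉ F, ∃ N, IsOpen N ∧ x ∈ N ∧ {i | (N ∩ W i).Nonempty}.Finite := by
    intro x hx
    simp only [hFdef, mem_ofPred_eq, not_forall, not_infinite] at hx
    obtain ⟨N, hN, hfin⟩ := hx
    obtain ⟨N', hN', ho, hm⟩ := mem_nhds_iff.1 hN
    exact ⟨N', ho, hm, hfin.subset fun i hi => hi.mono (inter_subset_inter_left _ hN')⟩
  have hF : IsClosed F := by
    refine isOpen_compl_iff.1 (isOpen_iff_mem_nhds.2 fun x hx => ?_)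
    obtain ⟨N, ho, hm, hfin⟩ := hcompl x hx
    exact mem_of_superset (ho.mem_nhds hm) fun z hz hzF => hzF N (ho.mem_nhds hz) hfin
  have hFS : F ⊆ S := by
    intro x hx
    by_contra hxS
    obtain ⟨N, hN, hfin⟩ := hWf x hxS
    exact hx N hN hfin
  have hFW : ∀ i, ∀ x ∈ W i, x ∉ F := by
    intro i x hx hxF
    refine hxF _ ((hWo i).mem_nhds hx) ((finite_singleton i).subset fun j hj => ?_)
    by_contra hij
    exact hj.not_disjoint (hWd fun h => hij h.symm)
  obtain ⟨T, hT, hFT, hTS⟩ := exists_isGδ_inter_subset hd hF hFS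
  obtain ⟨E, hEo, rfl⟩ := isGδ_iff_eq_iInter_nat.1 hT
  have hfin : ∀ n, {i | ¬ W i ⊆ E n}.Finite := by
    intro n
    have : {i | ((E n)ᶜ ∩ W i).Nonempty}.Finite := by
      refine (hEo n).isClosed_compl.isCompact.induction_on
        (p := fun s => {i | (s ∩ W i).Nonempty}.Finite) (by simp)
        (fun s t hst h => h.subset fun i hi => hi.mono (inter_subset_inter_left _ hst)) ?_ ?_
      · intro s t hs ht
        refine (hs.union ht).subset fun i hi => ?_
        simpa [union_inter_distrib_right] using hi
      · intro x hx
        obtain ⟨N, ho, hm, hfin⟩ := hcompl x fun h => hx (mem_iInter.1 (hFT h) n)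
        exact ⟨N, mem_nhdsWithin_of_mem_nhds (ho.mem_nhds hm), hfin⟩
    refine this.subset fun i hi => ?_
    obtain ⟨x, hx, hxE⟩ := not_subset.1 hi
    exact ⟨x, hxE, hx⟩
  have hc : (⋃ n, {i | ¬ W i ⊆ E n}).Countable := countable_iUnion fun n => (hfin n).countable
  refine countable_univ_iff.1 (hc.mono fun i _ => ?_)
  by_contra hi
  simp only [mem_iUnion, mem_ofPred_eq, not_exists, not_not] at hi
  obtain ⟨x, hxW, hxS⟩ := hS.inter_open_nonempty _ (hWo i) (hWn i)
  exact hFW i x hxW (hTS ⟨mem_iInter.2 fun n => hi n hxW, hxS⟩)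

/-- In a feebly compact situation the points of `S` have countable character in `X`. -/
lemma IsFeeblyCompactIn.exists_antitone_nhds [T2Space X] [RegularSpace X]
    (hfc : IsFeeblyCompactIn S) {U : Set X} (hU : IsOpen U) {O : ℕ → Set (X × X)}
    (hOa : Antitone O) (hOo : ∀ n, IsOpen (O n)) (hOd : ∀ n, ∀ x ∈ U ∩ S, (x, x) ∈ O n)
    (hOs : ∀ x ∈ U ∩ S, ∀ z ∈ U ∩ S, x ≠ z → ∃ n, (x, z) ∉ closure (O n))
    {x : X} (hx : x ∈ U ∩ S) :
    ∃ P : ℕ → Set X, Antitone P ∧ (∀ n, IsOpen (P n) ∧ x ∈ P n) ∧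
      ∀ V ∈ 𝓝 x, ∃ n, P n ⊆ V := by
  obtain ⟨U', hU', hxU', hcl⟩ := exists_open_closure_subset (hU.mem_nhds hx.1)
  have hPa : Antitone fun n => U' ∩ (fun z => (x, z)) ⁻¹' O n :=
    fun m n hmn => inter_subset_inter_right _ (preimage_mono (hOa hmn))
  have hPo : ∀ n, IsOpen (U' ∩ (fun z => (x, z)) ⁻¹' O n) :=
    fun n => hU'.inter ((hOo n).preimage (by fun_prop))
  refine ⟨fun n => U' ∩ (fun z => (x, z)) ⁻¹' O n, hPa, fun n => ⟨hPo n, hxU', hOd n x hx⟩, ?_⟩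
  intro V hV
  obtain ⟨C, hC, hCc, hCV⟩ := exists_mem_nhds_isClosed_subset hV
  suffices ∃ n, U' ∩ (fun z => (x, z)) ⁻¹' O n ⊆ C from this.imp fun n h => h.trans hCV
  by_contra! hne
  obtain ⟨y, hyS, hy⟩ := hfc (fun n => (U' ∩ (fun z => (x, z)) ⁻¹' O n) \ C)
    (fun n => (hPo n).sdiff hCc) (fun n => nonempty_of_not_subset (hne n))
  have hyx : x ≠ y := by
    rintro rfl
    obtain ⟨n, z, hzC, hz⟩ := (hy C hC).exists
    exact hz.2 hzC
  have hyU : y ∈ U := by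
    refine hcl (mem_closure_iff_nhds.2 fun N hN => ?_)
    obtain ⟨n, z, hzN, hz⟩ := (hy N hN).exists
    exact ⟨z, hzN, hz.1.1⟩
  obtain ⟨n, hn⟩ := hOs x hx y ⟨hyU, hyS⟩ hyx
  obtain ⟨P, R, -, hxP, hR, hyR, hPR⟩ := exists_disjoint_prod_of_notMem_closure hn
  obtain ⟨m, hnm, z, hzR, hz⟩ := frequently_atTop.1 (hy R (hR.mem_nhds hyR)) n
  exact hPR x hxP z hzR (hOa hnm hz.1.2)

lemma IsFeeblyCompactIn.exists_notMem_closure [T2Space X] [RegularSpace X]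
    (hfc : IsFeeblyCompactIn S) {U : Set X} (hU : IsOpen U) {O : ℕ → Set (X × X)}
    (hOa : Antitone O) (hOo : ∀ n, IsOpen (O n)) (hOd : ∀ n, ∀ x ∈ U ∩ S, (x, x) ∈ O n)
    (hOs : ∀ x ∈ U ∩ S, ∀ z ∈ U ∩ S, x ≠ z → ∃ n, (x, z) ∉ closure (O n))
    {x g : X} (hx : x ∈ U ∩ S) (hg : g ∈ U) (hxg : x ≠ g) : ∃ n, (x, g) ∉ closure (O n) := by
  by_contra! hne
  obtain ⟨P, hPa, hPo, hPb⟩ := hfc.exists_antitone_nhds hU hOa hOo hOd hOs hx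
  obtain ⟨W, hW, hgW, hcl⟩ := exists_open_closure_subset
    (inter_mem (hU.mem_nhds hg) (compl_singleton_mem_nhds hxg.symm))
  have hpt : ∀ n, ∃ p ∈ P n, ∃ r ∈ W, (p, r) ∈ O n := by
    intro n
    obtain ⟨⟨p, r⟩, ⟨hp, hr⟩, hpr⟩ := mem_closure_iff.1 (hne n) (P n ×ˢ W)
      ((hPo n).1.prod hW) ⟨(hPo n).2, hgW⟩
    exact ⟨p, hp, r, hr, hpr⟩
  choose p hpP r hrW hpr using hpt
  obtain ⟨z, hzS, hz⟩ := hfc (fun n => W ∩ (fun r => (p n, r)) ⁻¹' O n)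
    (fun n => hW.inter ((hOo n).preimage (by fun_prop))) (fun n => ⟨r n, hrW n, hpr n⟩)
  have hzW : z ∈ closure W := by
    refine mem_closure_iff_nhds.2 fun N hN => ?_
    obtain ⟨n, w, hwN, hw⟩ := (hz N hN).exists
    exact ⟨w, hwN, hw.1⟩
  obtain ⟨hzU, hzx⟩ := hcl hzW
  obtain ⟨n, hn⟩ := hOs x hx z ⟨hzU, hzS⟩ fun h => hzx h.symm
  obtain ⟨A, R, hA, hxA, hR, hzR, hAR⟩ := exists_disjoint_prod_of_notMem_closure hn
  obtain ⟨k, hk⟩ := hPb A (hA.mem_nhds hxA)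
  obtain ⟨m, hm, w, hwR, hw⟩ := frequently_atTop.1 (hz R (hR.mem_nhds hzR)) (max n k)
  exact hAR (p m) (hk (hPa ((le_max_right _ _).trans hm) (hpP m))) w hwR
    (hOa ((le_max_left _ _).trans hm) hw.2)

/-- A nonempty co-dense subspace which locally has a regular Gδ-diagonal is not feebly compact. -/
lemma not_isFeeblyCompactIn [T2Space X] [RegularSpace X] (hS' : Dense Sᶜ)
    (hne : S.Nonempty) (hd : LocallySeparatesDiagonal S) : ¬ IsFeeblyCompactIn S := by
  intro hfc
  obtain ⟨y, hy⟩ := hne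
  obtain ⟨U, hU, hyU, O, hOa, hOo, hOd, hOs⟩ := hd y hy
  obtain ⟨g, hgU, hgS⟩ := hS'.inter_open_nonempty U hU ⟨y, hyU⟩
  obtain ⟨U', hU', hgU', hcl⟩ := exists_open_closure_subset (hU.mem_nhds hgU)
  let A : ℕ → Set X := fun n => (fun x => (x, g)) ⁻¹' (closure (O n))ᶜ
  have hAo : ∀ n, IsOpen (A n) := fun n => isClosed_closure.isOpen_compl.preimage (by fun_prop)
  have hAm : Monotone A := fun m n hmn =>
    preimage_mono (compl_subset_compl.2 (closure_mono (hOa hmn)))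
  have hAc : ∀ x ∈ U ∩ S, ∃ n, x ∈ A n := fun x hx =>
    hfc.exists_notMem_closure hU hOa hOo hOd hOs hx hgU fun h => hgS (h ▸ hx.2)
  have hgA : ∀ n, g ∉ closure (A n) := by
    intro n hg
    have step : ∀ W : {W : Set X // IsOpen W ∧ g ∈ W}, ∃ W' : {W : Set X // IsOpen W ∧ g ∈ W},
        ∃ P : Set X, IsOpen P ∧ P.Nonempty ∧ P ⊆ W.1 ∧ W'.1 ⊆ W.1 ∧
          ∀ p ∈ P, ∀ w ∈ W'.1, (p, w) ∉ O n := by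
      rintro ⟨W, hW, hgW⟩
      obtain ⟨x, hxW, hxA⟩ := mem_closure_iff.1 hg W hW hgW
      obtain ⟨P, R, hP, hxP, hR, hgR, hPR⟩ := exists_disjoint_prod_of_notMem_closure hxA
      exact ⟨⟨W ∩ R, hW.inter hR, hgW, hgR⟩, P ∩ W, hP.inter hW, ⟨x, hxP, hxW⟩,
        inter_subset_right, inter_subset_left, fun p hp w hw => hPR p hp.1 w hw.2⟩
    choose next P hPo hPn hPW hnW hPO using step
    let W : ℕ → {W : Set X // IsOpen W ∧ g ∈ W} := fun k => next^[k] ⟨U', hU', hgU'⟩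
    have hWs : ∀ k, W (k + 1) = next (W k) := fun k => Function.iterate_succ_apply' _ _ _
    have hWa : Antitone fun k => (W k).1 := antitone_nat_of_succ_le fun k => by
      rw [hWs]; exact hnW _
    obtain ⟨z, hzS, hz⟩ := hfc (fun k => P (W k)) (fun k => hPo _) (fun k => hPn _)
    have hzU : z ∈ U := by
      refine hcl (mem_closure_iff_nhds.2 fun N hN => ?_)
      obtain ⟨k, w, hwN, hw⟩ := (hz N hN).exists
      exact ⟨w, hwN, hWa (Nat.zero_le k) (hPW _ hw)⟩
    obtain ⟨E, E', hE, hzE, hE', hzE', hEE⟩ := mem_nhds_prod_iff'.1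
      ((hOo n).mem_nhds (hOd n z ⟨hzU, hzS⟩))
    have hfr := frequently_atTop.1 (hz _ (inter_mem (hE.mem_nhds hzE) (hE'.mem_nhds hzE')))
    obtain ⟨i, -, a, ha, haP⟩ := hfr 0
    obtain ⟨j, hij, b, hb, hbP⟩ := hfr (i + 1)
    refine hPO (W i) a haP b ?_ (hEE ⟨ha.1, hb.2⟩)
    rw [← hWs]
    exact hWa hij (hPW _ hbP)
  obtain ⟨z, hzS, hz⟩ := hfc (fun n => U' \ closure (A n))
    (fun n => hU'.sdiff isClosed_closure) (fun n => ⟨g, hgU', hgA n⟩)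
  have hzU : z ∈ U := by
    refine hcl (mem_closure_iff_nhds.2 fun N hN => ?_)
    obtain ⟨k, w, hwN, hw⟩ := (hz N hN).exists
    exact ⟨w, hwN, hw.1⟩
  obtain ⟨n, hn⟩ := hAc z ⟨hzU, hzS⟩
  obtain ⟨m, hm, w, hw, hwA⟩ := frequently_atTop.1 (hz _ ((hAo n).mem_nhds hn)) n
  exact hwA.2 (subset_closure (hAm hm hw))

/-- There is a sequence of nonempty open sets converging to a compact set disjoint from `S`. -/
lemma exists_open_seq_tendsto_compact [CompactSpace X] [T2Space X] (hS' : Dense Sᶜ)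
    (hne : S.Nonempty) (hd : LocallySeparatesDiagonal S) :
    ∃ W : ℕ → Set X, (∀ n, IsOpen (W n)) ∧ (∀ n, (W n).Nonempty) ∧
      ∃ F ⊆ Sᶜ, IsClosed F ∧ ∀ V, IsOpen V → F ⊆ V → ∀ᶠ n in atTop, W n ⊆ V := by
  have h := not_isFeeblyCompactIn hS' hne hd
  simp only [IsFeeblyCompactIn, not_forall, not_exists, not_and, not_frequently] at h
  obtain ⟨W, hWo, hWn, hW⟩ := h
  refine ⟨W, hWo, hWn, {x | ∀ N ∈ 𝓝 x, ∃ᶠ n in atTop, (N ∩ W n).Nonempty}, ?_, ?_, ?_⟩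
  · intro x hx hxS
    obtain ⟨N, hN, hN'⟩ := hW x hxS
    exact (hx N hN).exists.elim fun n _ => (hx N hN) hN'
  · refine isOpen_compl_iff.1 (isOpen_iff_mem_nhds.2 fun x hx => ?_)
    simp only [mem_compl_iff, mem_ofPred_eq, not_forall, not_frequently] at hx
    obtain ⟨N, hN, hN'⟩ := hx
    filter_upwards [eventually_mem_nhds_iff.2 hN] with z hz hzF
    exact hzF N hz hN'
  · intro V hV hFV
    have : ∀ᶠ n in atTop, ¬ (Vᶜ ∩ W n).Nonempty := by
      refine hV.isClosed_compl.isCompact.induction_on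
        (p := fun s => ∀ᶠ n in atTop, ¬ (s ∩ W n).Nonempty) (by simp) ?_ ?_ ?_
      · exact fun s t hst h => h.mono fun n hn hs => hn (hs.mono (inter_subset_inter_left _ hst))
      · intro s t hs ht
        filter_upwards [hs, ht] with n h1 h2 h3
        rw [union_inter_distrib_right, union_nonempty] at h3
        exact h3.elim h1 h2
      · intro x hx
        have hxF := fun h => hx (hFV h)
        simp only [mem_ofPred_eq, not_forall, not_frequently, imp_false] at hxF
        obtain ⟨N, hN, hN'⟩ := hxF
        exact ⟨N, mem_nhdsWithin_of_mem_nhds hN, hN'⟩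
    filter_upwards [this] with n hn x hx
    by_contra hxV
    exact hn ⟨x, hxV, hx⟩

lemma isLindelof_of_countable_closed_nhds [CompactSpace X] {𝓑 : Set (Set X)} (h𝓑 : 𝓑.Countable)
    (hB : ∀ y ∈ S, ∀ g ∉ S, ∃ B ∈ 𝓑, B ∈ 𝓝 g ∧ y ∉ B) : IsLindelof S := by
  refine isLindelof_of_countable_subcover fun {ι} U hUo hSU => ?_
  have hC : IsCompact (⋃ i, U i)ᶜ := (isOpen_iUnion hUo).isClosed_compl.isCompact
  let 𝓣 : Set (Set (Set X)) := {t | t.Finite ∧ t ⊆ 𝓑} ∩ {t | (⋃ i, U i)ᶜ ⊆ ⋃ B ∈ t, interior B}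
  have h𝓣 : 𝓣.Countable := (countable_ofPred_finite_subset h𝓑).mono inter_subset_left
  have hfin : ∀ t : Set (Set X), ∃ u : Finset ι, t ∈ 𝓣 →
      (⋃ B ∈ t, interior B)ᶜ ⊆ ⋃ i ∈ u, U i := by
    intro t
    by_cases ht : t ∈ 𝓣
    · have hc : IsCompact (⋃ B ∈ t, interior B)ᶜ :=
        (isOpen_biUnion fun B _ => isOpen_interior).isClosed_compl.isCompact
      obtain ⟨u, hu⟩ := hc.elim_finite_subcover U hUo (compl_subset_comm.1 ht.2)
      exact ⟨u, fun _ => hu⟩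
    · exact ⟨∅, fun h => absurd h ht⟩
  choose u hu using hfin
  refine ⟨⋃ t ∈ 𝓣, (u t : Set ι), h𝓣.biUnion fun t _ => (u t).countable_toSet, fun y hy => ?_⟩
  have hex : ∃ t : Set (Set X), t.Finite ∧ t ⊆ 𝓑 ∧ (⋃ i, U i)ᶜ ⊆ ⋃ B ∈ t, interior B ∧
      ∀ B ∈ t, y ∉ B := by
    refine hC.induction_on (p := fun s => ∃ t : Set (Set X), t.Finite ∧ t ⊆ 𝓑 ∧
      s ⊆ ⋃ B ∈ t, interior B ∧ ∀ B ∈ t, y ∉ B) ⟨∅, by simp⟩ ?_ ?_ ?_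
    · rintro s s' hs ⟨t, h1, h2, h3, h4⟩
      exact ⟨t, h1, h2, hs.trans h3, h4⟩
    · rintro s s' ⟨t, h1, h2, h3, h4⟩ ⟨t', h1', h2', h3', h4'⟩
      refine ⟨t ∪ t', h1.union h1', union_subset h2 h2', ?_, ?_⟩
      · rw [biUnion_union]
        exact union_subset_union h3 h3'
      · rintro B (hB | hB)
        exacts [h4 B hB, h4' B hB]
    · intro g hg
      obtain ⟨B, hB𝓑, hBg, hyB⟩ := hB y hy g fun h => hg (hSU h)
      exact ⟨interior B, mem_nhdsWithin_of_mem_nhds (interior_mem_nhds.2 hBg), {B},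
        finite_singleton B, by simpa using hB𝓑, by simp, by simpa using hyB⟩
  obtain ⟨t, h1, h2, h3, h4⟩ := hex
  have hyt : y ∈ (⋃ B ∈ t, interior B)ᶜ := by
    simp only [mem_compl_iff, mem_iUnion, not_exists]
    exact fun B hB hyB => h4 B hB (interior_subset hyB)
  obtain ⟨i, hi, hyi⟩ := mem_iUnion₂.1 (hu t ⟨⟨h1, h2⟩, h3⟩ hyt)
  exact mem_iUnion₂.2 ⟨i, mem_iUnion₂.2 ⟨t, ⟨⟨h1, h2⟩, h3⟩, hi⟩, hyi⟩

/-- A Lindelöf subspace which locally has a regular Gδ-diagonal has a countable family of open sets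
whose closures separate its points. -/
lemma exists_countable_separating_of_isLindelof [RegularSpace X] (hL : IsLindelof S)
    (hd : LocallySeparatesDiagonal S) :
    ∃ 𝓔 : Set (Set X), 𝓔.Countable ∧ (∀ E ∈ 𝓔, IsOpen E) ∧
      ∀ x ∈ S, ∀ z ∈ S, x ≠ z → ∃ E ∈ 𝓔, x ∈ E ∧ z ∉ closure E := by
  choose! U hU hyU O hOa hOo hOd hOs using hd
  have hV : ∀ y ∈ S, ∃ V, IsOpen V ∧ y ∈ V ∧ closure V ⊆ U y :=
    fun y hy => exists_open_closure_subset ((hU y hy).mem_nhds (hyU y hy))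
  choose! V hVo hyV hVU using hV
  obtain ⟨D, hDc, hDS, hSD⟩ := hL.elim_nhds_subcover V fun y hy => (hVo y hy).mem_nhds (hyV y hy)
  have hE : ∀ y ∈ S, ∀ n : ℕ, ∀ x ∈ S ∩ closure (V y), ∃ E, IsOpen E ∧ x ∈ E ∧ E ×ˢ E ⊆ O y n := by
    intro y hy n x hx
    obtain ⟨A, B, hA, hxA, hB, hxB, hAB⟩ := mem_nhds_prod_iff'.1
      ((hOo y hy n).mem_nhds (hOd y hy n x ⟨hVU y hy hx.2, hx.1⟩))
    exact ⟨A ∩ B, hA.inter hB, ⟨hxA, hxB⟩,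
      (prod_mono inter_subset_left inter_subset_right).trans hAB⟩
  choose! E hEo hxE hEO using hE
  have hC : ∀ y ∈ S, ∀ n : ℕ, ∃ t : Set X, t.Countable ∧ (∀ x ∈ t, x ∈ S ∩ closure (V y)) ∧
      S ∩ closure (V y) ⊆ ⋃ x ∈ t, E y n x := fun y hy n =>
    (hL.inter_right isClosed_closure).elim_nhds_subcover (E y n)
      fun x hx => (hEo y hy n x hx).mem_nhds (hxE y hy n x hx)
  choose! t htc htS htE using hC
  refine ⟨V '' D ∪ ⋃ y ∈ D, ⋃ n, E y n '' t y n, ?_, ?_, ?_⟩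
  · exact (hDc.image _).union (hDc.biUnion fun y hy =>
      countable_iUnion fun n => (htc y (hDS y hy) n).image _)
  · rintro _ (⟨y, hy, rfl⟩ | h)
    · exact hVo y (hDS y hy)
    · simp only [mem_iUnion] at h
      obtain ⟨y, hy, n, x, hx, rfl⟩ := h
      exact hEo y (hDS y hy) n x (htS y (hDS y hy) n x hx)
  · intro x hx z hz hxz
    obtain ⟨y, hyD, hxy⟩ := mem_iUnion₂.1 (hSD hx)
    have hyS := hDS y hyD
    by_cases hzV : z ∈ closure (V y)
    · obtain ⟨n, hn⟩ := hOs y hyS x ⟨hVU y hyS (subset_closure hxy), hx⟩ z ⟨hVU y hyS hzV, hz⟩ hxz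
      obtain ⟨w, hw, hxw⟩ := mem_iUnion₂.1 (htE y hyS n ⟨hx, subset_closure hxy⟩)
      refine ⟨E y n w, Or.inr ?_, hxw, fun hzE => hn ?_⟩
      · simp only [mem_iUnion]
        exact ⟨y, hyD, n, w, hw, rfl⟩
      · refine closure_mono (hEO y hyS n w (htS y hyS n w hw)) ?_
        rw [closure_prod_eq]
        exact ⟨subset_closure hxw, hzE⟩
    · exact ⟨V y, Or.inl ⟨y, hyD, rfl⟩, hxy, hzV⟩

/-- In a compact space, finite intersections of open sets whose closures separate the points of `S`
from all other points form a base at every point of `S`. -/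
lemma exists_countable_local_base [CompactSpace X] {𝓔 : Set (Set X)} (h𝓔 : 𝓔.Countable)
    (ho : ∀ E ∈ 𝓔, IsOpen E) (hs : ∀ x ∈ S, ∀ z, x ≠ z → ∃ E ∈ 𝓔, x ∈ E ∧ z ∉ closure E) :
    ∃ 𝓢 : Set (Set X), 𝓢.Countable ∧ (∀ E ∈ 𝓢, IsOpen E) ∧
      ∀ x ∈ S, ∀ V, IsOpen V → x ∈ V → ∃ E ∈ 𝓢, x ∈ E ∧ E ⊆ V := by
  refine ⟨sInter '' {t | t.Finite ∧ t ⊆ 𝓔}, (countable_ofPred_finite_subset h𝓔).image _, ?_, ?_⟩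
  · rintro _ ⟨t, ⟨hf, ht⟩, rfl⟩
    exact hf.isOpen_sInter fun E hE => ho E (ht hE)
  · intro x hx V hV hxV
    have : ∃ t : Set (Set X), t.Finite ∧ t ⊆ 𝓔 ∧ x ∈ ⋂₀ t ∧ Disjoint Vᶜ (⋂₀ t) := by
      refine hV.isClosed_compl.isCompact.induction_on (p := fun s => ∃ t : Set (Set X),
        t.Finite ∧ t ⊆ 𝓔 ∧ x ∈ ⋂₀ t ∧ Disjoint s (⋂₀ t)) ⟨∅, by simp⟩ ?_ ?_ ?_
      · rintro s s' hss ⟨t, h1, h2, h3, h4⟩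
        exact ⟨t, h1, h2, h3, h4.mono_left hss⟩
      · rintro s s' ⟨t, h1, h2, h3, h4⟩ ⟨t', h1', h2', h3', h4'⟩
        refine ⟨t ∪ t', h1.union h1', union_subset h2 h2', ?_, ?_⟩
        · rw [sInter_union]; exact ⟨h3, h3'⟩
        · rw [sInter_union]
          exact disjoint_union_left.2 ⟨h4.mono_right inter_subset_left,
            h4'.mono_right inter_subset_right⟩
      · intro z hz
        obtain ⟨E, hE, hxE, hzE⟩ := hs x hx z fun h => hz (h ▸ hxV)
        refine ⟨(closure E)ᶜ,
          mem_nhdsWithin_of_mem_nhds (isClosed_closure.isOpen_compl.mem_nhds hzE),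
          {E}, finite_singleton E, by simpa using hE, by simpa using hxE, ?_⟩
        rw [sInter_singleton]
        exact (disjoint_compl_left).mono_right subset_closure
    obtain ⟨t, h1, h2, h3, h4⟩ := this
    exact ⟨⋂₀ t, ⟨t, ⟨h1, h2⟩, rfl⟩, h3, disjoint_compl_left_iff_subset.1 h4⟩

/-- A compact space with a countable family of open sets whose closures separate points is second
countable. -/
lemma secondCountableTopology_of_countable_separating [CompactSpace X] {𝓔 : Set (Set X)}
    (h𝓔 : 𝓔.Countable) (ho : ∀ E ∈ 𝓔, IsOpen E)
    (hs : ∀ x z, x ≠ z → ∃ E ∈ 𝓔, x ∈ E ∧ z ∉ closure E) : SecondCountableTopology X := by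
  obtain ⟨𝓢, hc, hSo, hSb⟩ := exists_countable_local_base (S := univ) h𝓔 ho fun x _ => hs x
  exact (TopologicalSpace.isTopologicalBasis_of_isOpen_of_nhds hSo
    fun x V hx hV => hSb x trivial V hV hx).secondCountableTopology hc

end Topological

section Group

lemma isCompact_union_range_of_eventually_mem {X : Type*} [TopologicalSpace X] {F : Set X}
    (hF : IsCompact F) {a : ℕ → X} (ha : ∀ P, IsOpen P → F ⊆ P → ∀ᶠ n in atTop, a n ∈ P) :
    IsCompact (F ∪ range a) := by
  classical
  refine isCompact_of_finite_subcover fun {ι} U hU hc => ?_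
  obtain ⟨t, ht⟩ := hF.elim_finite_subcover U hU (subset_union_left.trans hc)
  obtain ⟨N, hN⟩ := eventually_atTop.1 (ha _ (isOpen_biUnion fun i _ => hU i) ht)
  have hi : ∀ n, ∃ i, a n ∈ U i := fun n => mem_iUnion.1 (hc (Or.inr ⟨n, rfl⟩))
  choose i hi using hi
  refine ⟨t ∪ (Finset.range N).image i, union_subset ?_ ?_⟩
  · exact ht.trans (biUnion_subset_biUnion_left fun j hj => Finset.mem_union_left _ hj)
  · rintro _ ⟨n, rfl⟩
    rcases le_or_gt N n with h | h
    · obtain ⟨j, hj, hn⟩ := mem_iUnion₂.1 (hN n h)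
      exact mem_iUnion₂.2 ⟨j, Finset.mem_union_left _ hj, hn⟩
    · exact mem_iUnion₂.2 ⟨i n, Finset.mem_union_right _
        (Finset.mem_image_of_mem _ (Finset.mem_range.2 h)), hi n⟩

variable {G : Type*} [Group G] [TopologicalSpace G]

lemma isClosed_inter_inv_preimage [T2Space G]
    (hk : ∀ F : Set G, IsCompact F → IsCompact ((fun x : G => x⁻¹) '' F)) {C T : Set G}
    (hC : IsCompact C) (hT : IsClosed T) : IsClosed (C ∩ (fun x : G => x⁻¹) ⁻¹' T) := by
  have h := (hk _ ((hk C hC).inter_right hT)).isClosed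
  convert! h using 1
  ext x
  simp

/-- In a k-gentle paratopological group, a sequence of nonempty open sets converging to a compact
set can be translated to a sequence of neighborhoods of `1` converging to a compact set. -/
lemma exists_nhds_one_seq_tendsto_compact [ContinuousMul G] [T2Space G]
    (hk : ∀ F : Set G, IsCompact F → IsCompact ((fun x : G => x⁻¹) '' F))
    {V : ℕ → Set G} (hVo : ∀ n, IsOpen (V n)) (hVn : ∀ n, (V n).Nonempty) {F : Set G}
    (hF : IsCompact F) (hV : ∀ P, IsOpen P → F ⊆ P → ∀ᶠ n in atTop, V n ⊆ P) :
    ∃ N : ℕ → Set G, (∀ n, N n ∈ 𝓝 1) ∧ ∃ H : Set G, IsCompact H ∧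
      ∀ P, IsOpen P → H ⊆ P → ∀ᶠ n in atTop, N n ⊆ P := by
  choose g hg using hVn
  have hC : IsCompact (F ∪ range g) := isCompact_union_range_of_eventually_mem hF
    fun P hP hFP => (hV P hP hFP).mono fun n hn => hn (hg n)
  refine ⟨fun n => (fun x => g n * x) ⁻¹' V n, fun n => ?_,
    (fun p : G × G => p.1 * p.2) '' (((fun x : G => x⁻¹) '' F) ×ˢ F),
    ((hk F hF).prod hF).image continuous_mul, ?_⟩
  · exact ((hVo n).preimage (continuous_const_mul (g n))).mem_nhds (by simpa using hg n)
  · intro P hP hHP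
    obtain ⟨A, B, hA, hB, hFA, hFB, hAB⟩ := generalized_tube_lemma (hk F hF) hF
      (hP.preimage continuous_mul) (image_subset_iff.1 hHP)
    have hQ := isClosed_inter_inv_preimage hk hC hA.isClosed_compl
    filter_upwards [hV B hB hFB, hV _ hQ.isOpen_compl
      fun x hx h => h.2 (hFA (mem_image_of_mem _ hx))] with n h1 h2 x hx
    have hgA : (g n)⁻¹ ∈ A := by
      by_contra h
      exact h2 (hg n) ⟨Or.inr ⟨n, rfl⟩, h⟩
    have := hAB (mk_mem_prod hgA (h1 hx))
    simpa using this

lemma continuous_inv_of_nhds_one_seq [ContinuousMul G] [T2Space G] [RegularSpace G]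
    (hk : ∀ F : Set G, IsCompact F → IsCompact ((fun x : G => x⁻¹) '' F))
    {N : ℕ → Set G} (hN : ∀ n, N n ∈ 𝓝 1) {H : Set G} (hH : IsCompact H)
    (hNH : ∀ P, IsOpen P → H ⊆ P → ∀ᶠ n in atTop, N n ⊆ P) :
    Continuous (fun x : G => x⁻¹) := by
  have h1 : ContinuousAt (fun x : G => x⁻¹) 1 := by
    rw [ContinuousAt, (nhds_basis_opens _).tendsto_right_iff]
    rintro U ⟨h1U, hU⟩
    by_contra hA
    rw [not_eventually] at hA
    have hcl : (1 : G) ∈ closure (H ∩ (fun x : G => x⁻¹) ⁻¹' Uᶜ) := by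
      refine mem_closure_iff_nhds.2 fun V hV => ?_
      obtain ⟨C, hC, hCc, hCV⟩ := exists_mem_nhds_isClosed_subset hV
      have ha : ∀ n, ∃ a, a⁻¹ ∉ U ∧ a ∈ C ∩ N n := fun n =>
        (hA.and_eventually (inter_mem hC (hN n))).exists
      choose a haU haC using ha
      have hL : IsCompact (H ∪ range a) := isCompact_union_range_of_eventually_mem hH
        fun P hP hHP => (hNH P hP hHP).mono fun n hn => hn (haC n).2
      by_contra hempty
      have hB := (isClosed_inter_inv_preimage hk hL hU.isClosed_compl).inter hCc
      obtain ⟨n, hn⟩ := (hNH _ hB.isOpen_compl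
        fun x hx h => hempty ⟨x, hCV h.2, hx, h.1.2⟩).exists
      exact hn (haC n).2 ⟨⟨Or.inr ⟨n, rfl⟩, haU n⟩, (haC n).1⟩
    exact (isClosed_inter_inv_preimage hk hH hU.isClosed_compl).closure_subset hcl |>.2 h1U
  refine continuous_iff_continuousAt.2 fun x => ?_
  have h2 : ContinuousAt (fun z : G => (x⁻¹ * z)⁻¹ * x⁻¹) x := by
    refine ContinuousAt.mul (ContinuousAt.comp (g := fun x : G => x⁻¹) ?_ ?_) continuousAt_const
    · simpa using h1
    · exact (continuous_const_mul _).continuousAt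
  simpa using h2

/-- The group is covered by countably many translates of each neighborhood of `1`. -/
lemma exists_countable_translates_cover [IsTopologicalGroup G] {X : Type*} [TopologicalSpace X]
    [CompactSpace X] [T2Space X] {f : G → X} (hf : IsEmbedding f) (hfd : DenseRange f)
    (hS : Dense (range f)ᶜ) (hd : LocallySeparatesDiagonal (range f)ᶜ) {V : Set G}
    (hV : V ∈ 𝓝 1) : ∃ D : Set G, D.Countable ∧ ∀ g, ∃ d ∈ D, d⁻¹ * g ∈ V := by
  obtain ⟨M, hM, hMV⟩ := exists_nhds_split_inv hV
  obtain ⟨L', hL', hLM'⟩ := exists_nhds_split_inv hM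
  obtain ⟨L, hLL, hLo, h1L⟩ := mem_nhds_iff.1 (inter_mem hL' hM)
  obtain ⟨D, -, hDd, hDc⟩ := Vitali.exists_disjoint_subfamily_covering_enlargement
    (fun x : G => (fun h => x⁻¹ * h) ⁻¹' M) univ (fun _ => 1) 2 one_lt_two (by simp) 1 (by simp)
    (fun x _ => ⟨x, by simpa using mem_of_mem_nhds hM⟩)
  refine ⟨D, ?_, fun g => ?_⟩
  · have hW : ∀ x : D, ∃ W, IsOpen W ∧ f ⁻¹' W = (fun h => (x : G)⁻¹ * h) ⁻¹' L := fun x =>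
      hf.isOpen_iff.1 (hLo.preimage (continuous_const_mul _))
    choose W hWo hWf using hW
    have hmem : ∀ (x : D) h, f h ∈ W x ↔ (x : G)⁻¹ * h ∈ L := fun x h =>
      Set.ext_iff.1 (hWf x) h
    refine countable_coe_iff.1 (countable_of_pairwise_disjoint_of_locally_finite hS hd W hWo
      (fun x => ⟨f x, (hmem x x).2 (by simpa using h1L)⟩) ?_ ?_)
    · intro x y hxy
      refine disjoint_iff_inter_eq_empty.2 (not_nonempty_iff_eq_empty.1 fun hne => ?_)
      obtain ⟨h, hh⟩ := hfd.exists_mem_open ((hWo x).inter (hWo y)) hne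
      exact disjoint_left.1 (hDd x.2 y.2 fun h => hxy (Subtype.ext h))
        (hLL ((hmem x h).1 hh.1)).2 (hLL ((hmem y h).1 hh.2)).2
    · intro p hp
      obtain ⟨g, rfl⟩ := not_not.1 hp
      obtain ⟨Q, hQo, hQ⟩ := hf.isOpen_iff.1 (hLo.preimage (continuous_const_mul g⁻¹))
      have hQmem : ∀ h, f h ∈ Q ↔ g⁻¹ * h ∈ L := fun h => Set.ext_iff.1 hQ h
      refine ⟨Q, hQo.mem_nhds ((hQmem g).2 (by simpa using h1L)), Subsingleton.finite ?_⟩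
      have hin : ∀ x : D, (Q ∩ W x).Nonempty → (x : G)⁻¹ * g ∈ M := by
        intro x hx
        obtain ⟨h, hh⟩ := hfd.exists_mem_open (hQo.inter (hWo x)) hx
        have := hLM' _ (hLL ((hmem x h).1 hh.2)).1 _ (hLL ((hQmem h).1 hh.1)).1
        simpa [div_eq_mul_inv, mul_assoc] using this
      intro x hx y hy
      by_contra hxy
      exact disjoint_left.1 (hDd x.2 y.2 fun h => hxy (Subtype.ext h)) (hin x hx) (hin y hy)
  · obtain ⟨d, hd, ⟨h, hg, hh⟩, -⟩ := hDc g trivial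
    refine ⟨d, hd, ?_⟩
    simpa [div_eq_mul_inv, mul_assoc] using hMV _ hh _ hg

lemma exists_countable_closed_nhds [IsTopologicalGroup G] {X : Type*} [TopologicalSpace X]
    [CompactSpace X] [T2Space X] {f : G → X} (hf : IsEmbedding f) (hfd : DenseRange f)
    (hS : Dense (range f)ᶜ) (hd : LocallySeparatesDiagonal (range f)ᶜ)
    {N : ℕ → Set G} (hN : ∀ n, N n ∈ 𝓝 1) {H : Set G} (hH : IsCompact H)
    (hNH : ∀ P, IsOpen P → H ⊆ P → ∀ᶠ n in atTop, N n ⊆ P) :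
    ∃ 𝓑 : Set (Set X), 𝓑.Countable ∧ (∀ B ∈ 𝓑, IsClosed B) ∧
      ∀ y ∈ (range f)ᶜ, ∀ g ∉ (range f)ᶜ, ∃ B ∈ 𝓑, B ∈ 𝓝 g ∧ y ∉ B := by
  have hM : ∀ n, ∃ M : Set G, IsOpen M ∧ 1 ∈ M ∧ ∀ v ∈ M, ∀ w ∈ M, v⁻¹ * w ∈ N n := by
    intro n
    have : (fun p : G × G => p.1⁻¹ * p.2) ⁻¹' N n ∈ 𝓝 ((1, 1) : G × G) :=
      (continuous_fst.inv.mul continuous_snd).continuousAt (by simpa using hN n)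
    obtain ⟨A, B, hA, h1A, hB, h1B, hAB⟩ := mem_nhds_prod_iff'.1 this
    exact ⟨A ∩ B, hA.inter hB, ⟨h1A, h1B⟩, fun v hv w hw => hAB (mk_mem_prod hv.1 hw.2)⟩
  choose M hMo h1M hMN using hM
  have hD := fun n => exists_countable_translates_cover hf hfd hS hd ((hMo n).mem_nhds (h1M n))
  choose D hDc hD using hD
  refine ⟨⋃ n, (fun d => closure (f '' ((fun h => d⁻¹ * h) ⁻¹' M n))) '' D n,
    countable_iUnion fun n => (hDc n).image _, ?_, ?_⟩
  · intro B hB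
    obtain ⟨n, d, -, rfl⟩ := mem_iUnion.1 hB
    exact isClosed_closure
  · intro y hy p hp
    obtain ⟨g, rfl⟩ := not_not.1 hp
    have hK : IsCompact (f '' ((fun h => g * h) '' H)) :=
      (hH.image (continuous_const_mul g)).image hf.continuous
    have hyK : (f '' ((fun h => g * h) '' H))ᶜ ∈ 𝓝 y :=
      hK.isClosed.isOpen_compl.mem_nhds fun h => hy (image_subset_range _ _ h)
    obtain ⟨C, hC, hCc, hCK⟩ := exists_mem_nhds_isClosed_subset hyK
    obtain ⟨n, hn⟩ := (hNH ((fun h => f (g * h)) ⁻¹' Cᶜ)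
      (hCc.isOpen_compl.preimage (hf.continuous.comp (continuous_const_mul g)))
      fun h hh hC => hCK hC ⟨_, ⟨h, hh, rfl⟩, rfl⟩).exists
    obtain ⟨d, hdD, hdg⟩ := hD n g
    refine ⟨_, mem_iUnion.2 ⟨n, d, hdD, rfl⟩, ?_, fun hyB => ?_⟩
    · exact (IsDenseInducing.mk hf.isInducing hfd).closure_image_mem_nhds
        (((hMo n).preimage (continuous_const_mul _)).mem_nhds hdg)
    · obtain ⟨_, hz, h, hh, rfl⟩ := mem_closure_iff_nhds.1 hyB C hC
      refine hn (a := g⁻¹ * h) ?_ (by simpa using hz)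
      simpa [mul_assoc] using hMN n _ hdg _ hh

/-- A topological group with a countable π-base is second countable. -/
lemma secondCountableTopology_of_countable_piBase [IsTopologicalGroup G] {𝓒 : Set (Set G)}
    (hc : 𝓒.Countable) (ho : ∀ E ∈ 𝓒, IsOpen E ∧ E.Nonempty)
    (hb : ∀ V, IsOpen V → V.Nonempty → ∃ E ∈ 𝓒, E ⊆ V) : SecondCountableTopology G := by
  have hcg : (𝓝 (1 : G)).IsCountablyGenerated := by
    have hbasis : (𝓝 (1 : G)).HasBasis (· ∈ 𝓒) fun E => image2 (· / ·) E E := by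
      refine ⟨fun V => ⟨fun hV => ?_, ?_⟩⟩
      · obtain ⟨M, hM, hMV⟩ := exists_nhds_split_inv hV
        obtain ⟨E, hE, hEM⟩ := hb (interior M) isOpen_interior
          ⟨1, mem_interior_iff_mem_nhds.2 hM⟩
        exact ⟨E, hE, image2_subset_iff.2 fun a ha b hb =>
          hMV a (interior_subset (hEM ha)) b (interior_subset (hEM hb))⟩
      · rintro ⟨E, hE, hEV⟩
        obtain ⟨hEo, b, hb⟩ := ho E hE
        refine mem_of_superset ((hEo.preimage (continuous_mul_const b)).mem_nhds
          (by simpa using hb)) fun x hx => hEV ⟨x * b, hx, b, hb, by simp⟩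
    exact HasCountableBasis.isCountablyGenerated ⟨hbasis, hc⟩
  have hsep : TopologicalSpace.SeparableSpace G := by
    choose! x hx using fun E hE => (ho E hE).2
    refine ⟨x '' 𝓒, hc.image x, dense_iff_inter_open.2 fun V hV hVn => ?_⟩
    obtain ⟨E, hE, hEV⟩ := hb V hV hVn
    exact ⟨x E, hEV (hx E hE), E, hE, rfl⟩
  let := IsTopologicalGroup.rightUniformSpace G
  have : (uniformity G).IsCountablyGenerated := by
    rw [uniformity_eq_comap_nhds_one']
    infer_instance
  exact UniformSpace.secondCountable_of_separable G

lemma dense_compl_range_of_not_locallyCompactSpace [ContinuousMul G] [T2Space G] {X : Type*}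
    [TopologicalSpace X] [CompactSpace X] [T2Space X] {f : G → X} (hf : IsEmbedding f)
    (hfd : DenseRange f) (hG : ¬ LocallyCompactSpace G) : Dense (range f)ᶜ := by
  refine dense_iff_inter_open.2 fun W hW hWn => ?_
  by_contra hne
  have hsub : W ⊆ range f := by
    intro x hx
    by_contra hxf
    exact hne ⟨x, hx, hxf⟩
  obtain ⟨g, hg⟩ := hfd.exists_mem_open hW hWn
  obtain ⟨C, hC, hCc, hCW⟩ := exists_mem_nhds_isClosed_subset (hW.mem_nhds hg)
  have hK : IsCompact (f ⁻¹' C) := by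
    rw [hf.isCompact_iff, image_preimage_eq_of_subset (hCW.trans hsub)]
    exact hCc.isCompact
  have hKg : f ⁻¹' C ∈ 𝓝 g := hf.continuous.continuousAt hC
  have : WeaklyLocallyCompactSpace G := by
    refine ⟨fun x => ⟨Homeomorph.mulLeft (g * x⁻¹) ⁻¹' (f ⁻¹' C),
      (Homeomorph.mulLeft _).isCompact_preimage.2 hK,
      (Homeomorph.mulLeft _).continuous.continuousAt (by simpa using hKg)⟩⟩
  exact hG inferInstance

end Group

/-- Suppose `G` is a non-locally compact, k-gentle Tychonoff paratopological
group (inversion maps compact sets to compact sets), and `Y = bG \ G` is the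
remainder of `G` in a Hausdorff compactification `bG` of `G` (here `G` is
embedded densely into the compact Hausdorff space `bG` via `f`). If `Y`
locally has a regular Gδ-diagonal (every point of `Y` has an open neighborhood
whose closure in `Y` has a regular Gδ-diagonal), then `G` is a topological
group (inversion is continuous), and `G`, `bG` and `Y` are separable and
metrizable spaces. -/
theorem remainder_locally_regular_gdelta_diagonal {G bG : Type*}
    [Group G] [TopologicalSpace G] [ContinuousMul G] [T35Space G]
    [TopologicalSpace bG] [CompactSpace bG] [T2Space bG]
    (f : G → bG) (hf : Topology.IsEmbedding f) (hd : DenseRange f)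
    (hnlc : ¬ LocallyCompactSpace G)
    (hk : ∀ F : Set G, IsCompact F → IsCompact ((fun x : G => x⁻¹) '' F))
    (hY : ∀ y : ((Set.range f)ᶜ : Set bG), ∃ U : Set ((Set.range f)ᶜ : Set bG),
      IsOpen U ∧ y ∈ U ∧ HasRegularGDeltaDiagonal (closure U)) :
    Continuous (fun x : G => x⁻¹) ∧
    TopologicalSpace.SeparableSpace G ∧ TopologicalSpace.MetrizableSpace G ∧
    TopologicalSpace.SeparableSpace bG ∧ TopologicalSpace.MetrizableSpace bG ∧
    TopologicalSpace.SeparableSpace ((Set.range f)ᶜ : Set bG) ∧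
    TopologicalSpace.MetrizableSpace ((Set.range f)ᶜ : Set bG) := by
  have hS : Dense (range f)ᶜ := dense_compl_range_of_not_locallyCompactSpace hf hd hnlc
  have hS' : Dense (range f)ᶜᶜ := by rwa [compl_compl]
  have : Nonempty bG := ⟨f 1⟩
  have hdiag := locallySeparatesDiagonal_of_hasRegularGDeltaDiagonal hS hY
  obtain ⟨W, hWo, hWn, F, hFS, hFc, hWF⟩ := exists_open_seq_tendsto_compact hS' hS.nonempty hdiag
  rw [compl_compl] at hFS
  have hF : IsCompact (f ⁻¹' F) := by
    rw [hf.isCompact_iff, image_preimage_eq_of_subset hFS]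
    exact hFc.isCompact
  obtain ⟨N, hN, H, hH, hNH⟩ := exists_nhds_one_seq_tendsto_compact hk
    (V := fun n => f ⁻¹' W n) (fun n => (hWo n).preimage hf.continuous)
    (fun n => hd.exists_mem_open (hWo n) (hWn n)) hF (by
      intro P hP hFP
      obtain ⟨Q, hQ, rfl⟩ := hf.isOpen_iff.1 hP
      refine (hWF Q hQ fun x hx => ?_).mono fun n hn => preimage_mono hn
      obtain ⟨g, rfl⟩ := hFS hx
      exact hFP hx)
  have hinv : Continuous (fun x : G => x⁻¹) := continuous_inv_of_nhds_one_seq hk hN hH hNH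
  have : IsTopologicalGroup G := { continuous_inv := hinv }
  obtain ⟨𝓑, h𝓑, h𝓑c, hB⟩ := exists_countable_closed_nhds hf hd hS hdiag hN hH hNH
  obtain ⟨𝓔, h𝓔, h𝓔o, hE⟩ := exists_countable_separating_of_isLindelof
    (isLindelof_of_countable_closed_nhds h𝓑 hB) hdiag
  have h𝓔𝓑 : ∀ E ∈ 𝓔 ∪ compl '' 𝓑, IsOpen E := by
    rintro E (h | ⟨B, h, rfl⟩)
    exacts [h𝓔o E h, (h𝓑c B h).isOpen_compl]
  have hsep : ∀ x ∈ (range f)ᶜ, ∀ z, x ≠ z → ∃ E ∈ 𝓔 ∪ compl '' 𝓑, x ∈ E ∧ z ∉ closure E := by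
    intro x hx z hxz
    by_cases hz : z ∈ (range f)ᶜ
    · obtain ⟨E, hE, h⟩ := hE x hx z hz hxz
      exact ⟨E, Or.inl hE, h⟩
    · obtain ⟨B, hB, hBz, hxB⟩ := hB x hx z hz
      refine ⟨Bᶜ, Or.inr ⟨B, hB, rfl⟩, hxB, ?_⟩
      rw [closure_compl]
      exact fun h => h (mem_interior_iff_mem_nhds.2 hBz)
  obtain ⟨𝓢, h𝓢, h𝓢o, h𝓢b⟩ :=
    exists_countable_local_base (h𝓔.union (h𝓑.image _)) h𝓔𝓑 hsep
  have hG : SecondCountableTopology G := by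
    refine secondCountableTopology_of_countable_piBase
      (𝓒 := preimage f '' (𝓢 ∩ {E | E.Nonempty})) ((h𝓢.mono inter_subset_left).image _) ?_ ?_
    · rintro _ ⟨E, ⟨hE, hEn⟩, rfl⟩
      exact ⟨(h𝓢o E hE).preimage hf.continuous, hd.exists_mem_open (h𝓢o E hE) hEn⟩
    · rintro V hV ⟨g, hg⟩
      obtain ⟨Q, hQ, rfl⟩ := hf.isOpen_iff.1 hV
      obtain ⟨x, hxQ, hx⟩ := hS.inter_open_nonempty Q hQ ⟨f g, hg⟩
      obtain ⟨E, hE, hxE, hEQ⟩ := h𝓢b x hx Q hQ hxQ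
      exact ⟨f ⁻¹' E, ⟨E, ⟨hE, x, hxE⟩, rfl⟩, preimage_mono hEQ⟩
  have hb : SecondCountableTopology bG := by
    refine secondCountableTopology_of_countable_separating
      (𝓔 := (𝓔 ∪ compl '' 𝓑) ∪ (fun b => interior (closure (f '' b))) ''
        TopologicalSpace.countableBasis G)
      ((h𝓔.union (h𝓑.image _)).union ((TopologicalSpace.countable_countableBasis G).image _))
      ?_ ?_
    · rintro E (h | ⟨b, -, rfl⟩)
      exacts [h𝓔𝓑 E h, isOpen_interior]
    · intro x z hxz
      by_cases hx : x ∈ (range f)ᶜ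
      · obtain ⟨E, hE, h⟩ := hsep x hx z hxz
        exact ⟨E, Or.inl hE, h⟩
      · obtain ⟨g, rfl⟩ := not_not.1 hx
        obtain ⟨V, hV, hgV, hVz⟩ := exists_open_closure_subset (compl_singleton_mem_nhds hxz)
        obtain ⟨b, hb, hgb, hbV⟩ :=
          (TopologicalSpace.isBasis_countableBasis G).exists_subset_of_mem_open
            (show g ∈ f ⁻¹' V from hgV) (hV.preimage hf.continuous)
        refine ⟨_, Or.inr ⟨b, hb, rfl⟩, ?_, fun hz => ?_⟩
        · exact mem_interior_iff_mem_nhds.2 ((IsDenseInducing.mk hf.isInducing hd).closure_image_mem_nhds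
            ((TopologicalSpace.isOpen_of_mem_countableBasis hb).mem_nhds hgb))
        · exact hVz (closure_mono (image_subset_iff.2 hbV)
            (closure_minimal interior_subset isClosed_closure hz)) rfl
  have hbm : TopologicalSpace.MetrizableSpace bG := inferInstance
  exact ⟨hinv, inferInstance, hf.metrizableSpace, inferInstance, hbm, inferInstance, inferInstance⟩
end
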